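/- arXiv:2412.19029 — 3 statements merged into one kernel-verified Lean document; each statement's English description precedes it below -/
import Mathlib

section
/- Let (P_t)_{t≥0} be a Markov–Feller semigroup on a Polish space X that is Cesàro eventually continuous on X. Then for every x ∈ T the measures Q_t(x,·) converge weakly, as t → ∞, to an invariant probability measure ε_x. Moreover, for every Borel probability measure μ with supp μ ⊆ T, the measures Q_t μ converge weakly, as t → ∞, to the probability measure ν defined by ν(A) = ∫_T ε_x(A) μ(dx) for Borel sets A, and ν is invariant for (P_t). -/
open MeasureTheory Filter Metric Set Topology
open scoped ENNReal

/-- A Markov–Feller semigroup on a metric measurable space `X`: a family of Markov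
kernels `P t` (for `t ≥ 0`) such that `P 0` is the identity kernel, the
Chapman–Kolmogorov semigroup property holds, `x ↦ ∫ f d(P t x)` is continuous for
every bounded continuous `f` (Feller property), and `t ↦ ∫ f d(P t x)` is Borel
measurable. -/
structure MarkovFellerSemigroup (X : Type*) [MetricSpace X] [MeasurableSpace X]
    [BorelSpace X] where
  P : ℝ → X → Measure X
  isProb : ∀ t, 0 ≤ t → ∀ x, IsProbabilityMeasure (P t x)
  measurable_x : ∀ t, 0 ≤ t → Measurable (P t)
  id0 : ∀ x, P 0 x = Measure.dirac x
  semigroup : ∀ s t : ℝ, 0 ≤ s → 0 ≤ t → ∀ x, P (t + s) x = (P t x).bind (P s)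
  feller : ∀ (f : BoundedContinuousFunction X ℝ) (t : ℝ), 0 ≤ t →
    Continuous fun x => ∫ y, f y ∂ P t x
  measurable_t : ∀ (f : BoundedContinuousFunction X ℝ) (x : X),
    Measurable fun t : ℝ => ∫ y, f y ∂ P t x

namespace MarkovFellerSemigroup

variable {X : Type*} [MetricSpace X] [MeasurableSpace X] [BorelSpace X]

/-- `P_t f (x) = ∫ f(y) P_t(x, dy)`. -/
noncomputable def Pf (S : MarkovFellerSemigroup X) (t : ℝ) (f : X → ℝ) (x : X) : ℝ :=
  ∫ y, f y ∂ S.P t x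

/-- The Cesàro average `Q_t f (x) = (1/t) ∫_0^t P_s f (x) ds`. -/
noncomputable def Qf (S : MarkovFellerSemigroup X) (t : ℝ) (f : X → ℝ) (x : X) : ℝ :=
  (1 / t) * ∫ s in (0:ℝ)..t, S.Pf s f x

/-- The Cesàro average `Q_t(x, A) = (1/t) ∫_0^t P_s(x, A) ds`. -/
noncomputable def Qmeas (S : MarkovFellerSemigroup X) (t : ℝ) (x : X) (A : Set X) : ℝ :=
  (1 / t) * ∫ s in (0:ℝ)..t, (S.P s x A).toReal

/-- The action `P_t μ = ∫ P_t(x, ·) μ(dx)` of the semigroup on measures. -/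
noncomputable def Pmeas (S : MarkovFellerSemigroup X) (t : ℝ) (μ : Measure X) : Measure X :=
  μ.bind (S.P t)

/-- `⟨f, Q_t μ⟩ = (1/t) ∫_0^t ⟨f, P_s μ⟩ ds`. -/
noncomputable def QfM (S : MarkovFellerSemigroup X) (t : ℝ) (f : X → ℝ) (μ : Measure X) : ℝ :=
  (1 / t) * ∫ s in (0:ℝ)..t, ∫ x, S.Pf s f x ∂μ

/-- The set `T` of points `x` for which the family `{Q_t(x,·)}_{t>0}` is tight. -/
def Tset (S : MarkovFellerSemigroup X) : Set X :=
  {x | ∀ ε > (0:ℝ), ∃ K : Set X, IsCompact K ∧ ∀ t > (0:ℝ), 1 - ε ≤ S.Qmeas t x K}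

/-- Bounded Lipschitz real-valued functions, the class `L_b(X)`. -/
def IsBddLipschitz (f : X → ℝ) : Prop :=
  (∃ K, LipschitzWith K f) ∧ ∃ M, ∀ x, |f x| ≤ M

/-- Eventual continuity at `z`: for every bounded Lipschitz `f`,
`limsup_{x → z} limsup_{t → ∞} |P_t f(x) − P_t f(z)| = 0`. -/
def EvContAt (S : MarkovFellerSemigroup X) (z : X) : Prop :=
  ∀ f : X → ℝ, IsBddLipschitz f →
    limsup (fun x => limsup (fun t => |S.Pf t f x - S.Pf t f z|) atTop) (𝓝 z) = 0

/-- Cesàro eventual continuity at `z`: for every bounded Lipschitz `f`,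
`limsup_{x → z} limsup_{t → ∞} |Q_t f(x) − Q_t f(z)| = 0`. -/
def CesaroEvContAt (S : MarkovFellerSemigroup X) (z : X) : Prop :=
  ∀ f : X → ℝ, IsBddLipschitz f →
    limsup (fun x => limsup (fun t => |S.Qf t f x - S.Qf t f z|) atTop) (𝓝 z) = 0

/-- An invariant probability measure of the semigroup. -/
def Invariant (S : MarkovFellerSemigroup X) (μ : Measure X) : Prop :=
  IsProbabilityMeasure μ ∧ ∀ t, 0 ≤ t → S.Pmeas t μ = μ

/-- An ergodic invariant probability measure: an invariant probability measure `μ`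
such that whenever `μ = (1/2)(μ₁ + μ₂)` with `μ₁, μ₂` invariant probability
measures, `μ₁ = μ₂ = μ`. -/
def ErgodicInv (S : MarkovFellerSemigroup X) (μ : Measure X) : Prop :=
  S.Invariant μ ∧ ∀ μ₁ μ₂ : Measure X, S.Invariant μ₁ → S.Invariant μ₂ →
    μ = (2 : ℝ≥0∞)⁻¹ • (μ₁ + μ₂) → μ₁ = μ ∧ μ₂ = μ

/-- The support of a measure: points all of whose balls have positive measure. -/
def msupp (μ : Measure X) : Set X :=
  {x | ∀ ε > (0:ℝ), 0 < μ (ball x ε)}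

/-- `Q_t(x,·)` converges weakly to `μ` as `t → ∞`. -/
def QWeakLim (S : MarkovFellerSemigroup X) (x : X) (μ : Measure X) : Prop :=
  ∀ f : BoundedContinuousFunction X ℝ,
    Tendsto (fun t => S.Qf t f x) atTop (𝓝 (∫ y, f y ∂μ))

/-- `Q_t ν` converges weakly to `μ` as `t → ∞`. -/
def QWeakLimM (S : MarkovFellerSemigroup X) (ν : Measure X) (μ : Measure X) : Prop :=
  ∀ f : BoundedContinuousFunction X ℝ,
    Tendsto (fun t => S.QfM t f ν) atTop (𝓝 (∫ y, f y ∂μ))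

end MarkovFellerSemigroup

namespace MarkovFellerSemigroup

open BoundedContinuousFunction ProbabilityTheory

section aux

variable {X : Type*} [MetricSpace X] [MeasurableSpace X] [BorelSpace X]

theorem aux_measurable_of_integrals {α : Type*} [MeasurableSpace α] (m : α → Measure X)
    (hm : ∀ a, IsProbabilityMeasure (m a))
    (hf : ∀ f : BoundedContinuousFunction X ℝ, Measurable fun a => ∫ y, f y ∂ m a) :
    Measurable m := by
  refine Measurable.measure_of_isPiSystem_of_isProbabilityMeasure
    (S := {F : Set X | IsClosed F}) ?_ isPiSystem_isClosed ?_
  · rw [BorelSpace.measurable_eq (α := X), borel_eq_generateFrom_isClosed]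
  · intro F hF
    have hpos : ∀ n : ℕ, (0:ℝ) < 1 / ((n:ℝ) + 1) := fun n => Nat.one_div_pos_of_nat
    have hlim : ∀ a, Tendsto (fun n : ℕ => ∫⁻ y, (thickenedIndicator (hpos n) F y : ℝ≥0∞) ∂ m a)
        atTop (𝓝 (m a F)) := fun a =>
      tendsto_lintegral_thickenedIndicator_of_isClosed (m a) hF hpos
        tendsto_one_div_add_atTop_nhds_zero_nat
    refine measurable_of_tendsto_metrizable (f := fun (n : ℕ) a =>
      ∫⁻ y, (thickenedIndicator (hpos n) F y : ℝ≥0∞) ∂ m a) ?_ (tendsto_pi_nhds.2 hlim)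
    intro n
    let g : BoundedContinuousFunction X ℝ :=
      BoundedContinuousFunction.ofNormedAddCommGroup
        (fun y => (thickenedIndicator (hpos n) F y : ℝ)) (by fun_prop) 1 (by
          intro y
          simpa using thickenedIndicator_le_one (hpos n) F y)
    have h1 : (fun a => ∫⁻ y, (thickenedIndicator (hpos n) F y : ℝ≥0∞) ∂ m a)
        = fun a => ENNReal.ofReal (∫ y, g y ∂ m a) := by
      funext a
      have h2 := integrable_thickenedIndicator (μ := m a) F (hpos n)
      rw [ofReal_integral_eq_lintegral_ofReal (g.integrable (m a))
        (Eventually.of_forall fun y => NNReal.coe_nonneg _)]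
      refine lintegral_congr fun y => ?_
      change _ = ENNReal.ofReal ((thickenedIndicator (hpos n) F y : ℝ))
      simp
    change Measurable (fun a => ∫⁻ y, (thickenedIndicator (hpos n) F y : ℝ≥0∞) ∂ m a)
    rw [h1]
    exact (hf g).ennreal_ofReal

theorem aux_integral_bind {α β : Type*} [MeasurableSpace α] [MeasurableSpace β] (m : Measure α)
    [IsFiniteMeasure m] (κ : α → Measure β) (hκ : Measurable κ)
    (hp : ∀ a, IsProbabilityMeasure (κ a)) (f : β → ℝ) (hf : Measurable f) (C : ℝ)
    (hC : ∀ x, |f x| ≤ C) :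
    ∫ y, f y ∂ (m.bind κ) = ∫ a, ∫ y, f y ∂ κ a ∂ m := by
  let k : Kernel α β := ⟨κ, hκ⟩
  haveI : IsMarkovKernel k := ⟨hp⟩
  have hi : Integrable f ((k ∘ₖ Kernel.const Unit m) ()) :=
    Integrable.of_bound hf.aestronglyMeasurable C (Eventually.of_forall hC)
  have h := Kernel.integral_comp hi
  rw [Kernel.comp_apply] at h
  exact h

/-- The semigroup extended to all times. -/
noncomputable def PP (S : MarkovFellerSemigroup X) (s : ℝ) (x : X) : Measure X := S.P (max s 0) x

instance (S : MarkovFellerSemigroup X) (s : ℝ) (x : X) : IsProbabilityMeasure (S.PP s x) :=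
  S.isProb _ (le_max_right _ _) x

/-- `P_s f` as a bounded continuous function. -/
noncomputable def PB (S : MarkovFellerSemigroup X) (s : ℝ) (f : BoundedContinuousFunction X ℝ) :
    BoundedContinuousFunction X ℝ :=
  BoundedContinuousFunction.ofNormedAddCommGroup (fun x => ∫ y, f y ∂ S.PP s x)
    (S.feller f _ (le_max_right _ _)) ‖f‖ (by
      intro x
      have := norm_integral_le_of_norm_le_const (μ := S.PP s x) (f := f) (C := ‖f‖)
        (Eventually.of_forall f.norm_coe_le_norm)
      simpa using this)

theorem PB_apply (S : MarkovFellerSemigroup X) (s : ℝ) (f : BoundedContinuousFunction X ℝ) (x : X) :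
    S.PB s f x = ∫ y, f y ∂ S.PP s x := rfl

theorem PB_norm (S : MarkovFellerSemigroup X) (s : ℝ) (f : BoundedContinuousFunction X ℝ) :
    ‖S.PB s f‖ ≤ ‖f‖ :=
  BoundedContinuousFunction.norm_ofNormedAddCommGroup_le _ (norm_nonneg _) _

theorem PB_abs (S : MarkovFellerSemigroup X) (s : ℝ) (f : BoundedContinuousFunction X ℝ) (x : X) :
    |S.PB s f x| ≤ ‖f‖ :=
  ((S.PB s f).norm_coe_le_norm x).trans (S.PB_norm s f)

theorem PB_meas_t (S : MarkovFellerSemigroup X) (f : BoundedContinuousFunction X ℝ) (x : X) :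
    Measurable fun s => S.PB s f x :=
  (S.measurable_t f x).comp (measurable_id.max measurable_const)

theorem PP_meas_t (S : MarkovFellerSemigroup X) (x : X) : Measurable fun s => S.PP s x :=
  aux_measurable_of_integrals _ (fun _ => inferInstance) fun f => S.PB_meas_t f x

theorem PB_joint [TopologicalSpace.SeparableSpace X]
    (S : MarkovFellerSemigroup X) (f : BoundedContinuousFunction X ℝ) :
    Measurable fun p : X × ℝ => S.PB p.2 f p.1 := by
  haveI := UniformSpace.secondCountable_of_separable X
  exact measurable_uncurry_of_continuous_of_measurable (u := fun x s => S.PB s f x)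
    (fun s => (S.PB s f).continuous) (fun x => S.PB_meas_t f x)

theorem PB_PB (S : MarkovFellerSemigroup X) {r s : ℝ} (hr : 0 ≤ r) (hs : 0 ≤ s)
    (f : BoundedContinuousFunction X ℝ) (x : X) : S.PB r (S.PB s f) x = S.PB (r + s) f x := by
  rw [PB_apply, PB_apply, PP, PP, max_eq_left hr, max_eq_left (add_nonneg hr hs),
    S.semigroup s r hs hr x]
  haveI := S.isProb r hr x
  rw [aux_integral_bind (S.P r x) (S.P s) (S.measurable_x s hs) (S.isProb s hs) f
    f.continuous.measurable ‖f‖ (fun y => f.norm_coe_le_norm y)]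
  simp only [PB_apply, PP, max_eq_left hs]

/-- Uniform measure on `(0,t]`. -/
noncomputable def UU (t : ℝ) : Measure ℝ := ENNReal.ofReal (1 / t) • volume.restrict (Ioc 0 t)

theorem UU_prob {t : ℝ} (ht : 0 < t) : IsProbabilityMeasure (UU t) := by
  constructor
  simp only [UU, Measure.smul_apply, Measure.restrict_apply MeasurableSet.univ, univ_inter,
    Real.volume_Ioc, smul_eq_mul, sub_zero]
  rw [← ENNReal.ofReal_mul (by positivity), one_div_mul_cancel ht.ne', ENNReal.ofReal_one]

theorem UU_ae (t : ℝ) : ∀ᵐ s ∂ UU t, 0 < s ∧ s ≤ t := by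
  have : ∀ᵐ s ∂ (volume.restrict (Ioc 0 t)), s ∈ Ioc 0 t := ae_restrict_mem measurableSet_Ioc
  exact Measure.ae_smul_measure this _

instance (t : ℝ) : IsFiniteMeasure (UU t) := by
  rcases lt_or_ge 0 t with h | h
  · haveI := UU_prob h; infer_instance
  · have : UU t = 0 := by simp [UU, Ioc_eq_empty (not_lt.2 h)]
    rw [this]; infer_instance

theorem UU_real_le (t : ℝ) : (UU t).real univ ≤ 1 := by
  rcases lt_or_ge 0 t with h | h
  · haveI := UU_prob h; simp
  · have : UU t = 0 := by simp [UU, Ioc_eq_empty (not_lt.2 h)]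
    rw [this]; simp

theorem UU_integral {t : ℝ} (ht : 0 < t) (g : ℝ → ℝ) :
    ∫ s, g s ∂ UU t = (1 / t) * ∫ s in (0:ℝ)..t, g s := by
  rw [UU, integral_smul_measure, intervalIntegral.integral_of_le ht.le,
    ENNReal.toReal_ofReal (by positivity), smul_eq_mul]

/-- `Q_t f` as a bounded continuous function. -/
noncomputable def QB (S : MarkovFellerSemigroup X) (t : ℝ) (f : BoundedContinuousFunction X ℝ) :
    BoundedContinuousFunction X ℝ :=
  BoundedContinuousFunction.ofNormedAddCommGroup (fun x => ∫ s, S.PB s f x ∂ UU t)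
    (continuous_of_dominated (bound := fun _ => ‖f‖)
      (fun x => (S.PB_meas_t f x).aestronglyMeasurable)
      (fun x => Eventually.of_forall fun s => S.PB_abs s f x) (integrable_const _)
      (Eventually.of_forall fun s => (S.PB s f).continuous)) ‖f‖ (by
      intro x
      have := norm_integral_le_of_norm_le_const (μ := UU t) (f := fun s => S.PB s f x) (C := ‖f‖)
        (Eventually.of_forall fun s => S.PB_abs s f x)
      refine this.trans ?_
      exact mul_le_of_le_one_right (norm_nonneg _) (UU_real_le t))

theorem QB_apply (S : MarkovFellerSemigroup X) (s : ℝ) (f : BoundedContinuousFunction X ℝ) (x : X) :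
    S.QB s f x = ∫ r, S.PB r f x ∂ UU s := rfl

theorem QB_norm (S : MarkovFellerSemigroup X) (s : ℝ) (f : BoundedContinuousFunction X ℝ) :
    ‖S.QB s f‖ ≤ ‖f‖ :=
  BoundedContinuousFunction.norm_ofNormedAddCommGroup_le _ (norm_nonneg _) _

theorem QB_abs (S : MarkovFellerSemigroup X) (s : ℝ) (f : BoundedContinuousFunction X ℝ) (x : X) :
    |S.QB s f x| ≤ ‖f‖ :=
  ((S.QB s f).norm_coe_le_norm x).trans (S.QB_norm s f)

theorem Qf_eq (S : MarkovFellerSemigroup X) {t : ℝ} (ht : 0 < t)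
    (f : BoundedContinuousFunction X ℝ) (x : X) : S.Qf t f x = S.QB t f x := by
  rw [QB_apply, UU_integral ht, Qf]
  congr 1
  refine intervalIntegral.integral_congr fun s hs => ?_
  rw [uIcc_of_le ht.le] at hs
  simp only [PB_apply, PP, max_eq_left hs.1, Pf]

theorem QB_fubini [TopologicalSpace.SeparableSpace X] (S : MarkovFellerSemigroup X) (t : ℝ)
    (f : BoundedContinuousFunction X ℝ) (m : Measure X) [IsFiniteMeasure m] :
    ∫ x, S.QB t f x ∂m = ∫ s, ∫ x, S.PB s f x ∂m ∂ UU t := by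
  simp only [QB_apply]
  refine integral_integral_swap ?_
  exact Integrable.of_bound (S.PB_joint f).aestronglyMeasurable ‖f‖
    (Eventually.of_forall fun p => S.PB_abs _ _ _)

/-- `Q_t(x,·)` as a measure. -/
noncomputable def QQ (S : MarkovFellerSemigroup X) (t : ℝ) (x : X) : Measure X :=
  (UU t).bind fun s => S.PP s x

theorem QQ_apply (S : MarkovFellerSemigroup X) (t : ℝ) (x : X) {A : Set X} (hA : MeasurableSet A) :
    S.QQ t x A = ∫⁻ s, S.PP s x A ∂ UU t :=
  Measure.bind_apply hA (S.PP_meas_t x).aemeasurable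

theorem QQ_prob (S : MarkovFellerSemigroup X) {t : ℝ} (ht : 0 < t) (x : X) :
    IsProbabilityMeasure (S.QQ t x) := by
  haveI := UU_prob ht
  constructor
  rw [QQ_apply _ _ _ MeasurableSet.univ]
  simp

theorem QQ_Qmeas (S : MarkovFellerSemigroup X) {t : ℝ} (ht : 0 < t) (x : X) {A : Set X}
    (hA : MeasurableSet A) : S.Qmeas t x A = (S.QQ t x).real A := by
  rw [Measure.real, QQ_apply _ _ _ hA, Qmeas]
  rw [← integral_toReal (f := fun s => S.PP s x A)
    ((Measure.measurable_coe hA).comp (S.PP_meas_t x)).aemeasurable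
    (Eventually.of_forall fun s => measure_lt_top _ _), UU_integral ht]
  congr 1
  refine intervalIntegral.integral_congr fun s hs => ?_
  rw [uIcc_of_le ht.le] at hs
  simp only [PP, max_eq_left hs.1]

theorem QQ_integral (S : MarkovFellerSemigroup X) (t : ℝ) (x : X)
    (f : BoundedContinuousFunction X ℝ) : ∫ y, f y ∂ S.QQ t x = S.QB t f x := by
  rw [QQ, aux_integral_bind (UU t) _ (S.PP_meas_t x) (fun _ => inferInstance) f
    f.continuous.measurable ‖f‖ (fun y => f.norm_coe_le_norm y)]
  rfl

theorem QB_PB_sub (S : MarkovFellerSemigroup X) {t r : ℝ} (ht : 0 < t) (hr : 0 ≤ r)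
    (f : BoundedContinuousFunction X ℝ) (x : X) :
    |S.QB t (S.PB r f) x - S.QB t f x| ≤ 2 * r * ‖f‖ / t := by
  have hi : ∀ a b, IntervalIntegrable (fun s => S.PB s f x) volume a b := fun a b =>
    (intervalIntegrable_const (c := ‖f‖)).mono_fun (S.PB_meas_t f x).aestronglyMeasurable
      (Eventually.of_forall fun s => by
        simpa using S.PB_abs s f x)
  have h1 : S.QB t (S.PB r f) x = (1 / t) * ∫ s in r..(t + r), S.PB s f x := by
    rw [QB_apply, UU_integral ht]
    congr 1
    have := intervalIntegral.integral_comp_add_right (a := 0) (b := t)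
      (fun s => S.PB s f x) r
    rw [zero_add] at this
    rw [← this]
    refine intervalIntegral.integral_congr fun s hs => ?_
    rw [uIcc_of_le ht.le] at hs
    exact S.PB_PB hs.1 hr f x
  have h2 : (∫ s in r..(t + r), S.PB s f x) - (∫ s in (0:ℝ)..t, S.PB s f x)
      = (∫ s in t..(t + r), S.PB s f x) - ∫ s in (0:ℝ)..r, S.PB s f x := by
    have e1 := intervalIntegral.integral_add_adjacent_intervals (hi 0 r) (hi r (t + r))
    have e2 := intervalIntegral.integral_add_adjacent_intervals (hi 0 t) (hi t (t + r))
    linarith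
  have b1 : |∫ s in t..(t + r), S.PB s f x| ≤ ‖f‖ * r := by
    have := intervalIntegral.norm_integral_le_of_norm_le_const (a := t) (b := t + r)
      (f := fun s => S.PB s f x) (C := ‖f‖) (fun s _ => S.PB_abs s f x)
    simpa [abs_of_nonneg hr] using this
  have b2 : |∫ s in (0:ℝ)..r, S.PB s f x| ≤ ‖f‖ * r := by
    have := intervalIntegral.norm_integral_le_of_norm_le_const (a := 0) (b := r)
      (f := fun s => S.PB s f x) (C := ‖f‖) (fun s _ => S.PB_abs s f x)
    simpa [abs_of_nonneg hr] using this
  rw [h1, QB_apply S t f x, UU_integral ht, ← mul_sub, h2, abs_mul, abs_of_pos (by positivity),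
    one_div, div_eq_inv_mul (2 * r * ‖f‖)]
  refine mul_le_mul_of_nonneg_left ?_ (by positivity)
  calc _ ≤ _ := abs_sub _ _
    _ ≤ ‖f‖ * r + ‖f‖ * r := add_le_add b1 b2
    _ = _ := by ring

theorem QB_QB [TopologicalSpace.SeparableSpace X] (S : MarkovFellerSemigroup X) (s t : ℝ)
    (f : BoundedContinuousFunction X ℝ) (x : X) :
    S.QB t (S.QB s f) x = ∫ r, S.QB t (S.PB r f) x ∂ UU s := by
  rw [← QQ_integral]
  haveI : IsFiniteMeasure (S.QQ t x) := by
    constructor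
    rw [QQ_apply _ _ _ MeasurableSet.univ]
    simp
  rw [QB_fubini]
  simp only [QQ_integral]

theorem QB_PB_comm [TopologicalSpace.SeparableSpace X] (S : MarkovFellerSemigroup X) {r : ℝ}
    (hr : 0 ≤ r) (t : ℝ) (f : BoundedContinuousFunction X ℝ) (x : X) :
    S.PB r (S.QB t f) x = S.QB t (S.PB r f) x := by
  rw [PB_apply, QB_fubini, QB_apply]
  refine integral_congr_ae ?_
  filter_upwards [UU_ae t] with s hs
  rw [← PB_apply, PB_PB _ hr hs.1.le, PB_PB _ hs.1.le hr, add_comm]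

theorem QB_comm [TopologicalSpace.SeparableSpace X] (S : MarkovFellerSemigroup X) (s t : ℝ)
    (f : BoundedContinuousFunction X ℝ) (x : X) :
    S.QB t (S.QB s f) x = S.QB s (S.QB t f) x := by
  rw [QB_QB, QB_apply S s]
  refine integral_congr_ae ?_
  filter_upwards [UU_ae s] with r hr
  rw [QB_PB_comm _ hr.1.le]

theorem QB_QB_sub [TopologicalSpace.SeparableSpace X] (S : MarkovFellerSemigroup X) {s t : ℝ}
    (hs : 0 < s) (ht : 0 < t) (f : BoundedContinuousFunction X ℝ) (x : X) :
    |S.QB t (S.QB s f) x - S.QB t f x| ≤ 2 * s * ‖f‖ / t := by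
  haveI := UU_prob hs
  have hmeas : Measurable fun r => S.QB t (S.PB r f) x := by
    haveI : IsFiniteMeasure (S.QQ t x) := by
      haveI := S.QQ_prob ht x
      infer_instance
    have : (fun r => S.QB t (S.PB r f) x) = fun r => ∫ y, S.PB r f y ∂ S.QQ t x := by
      funext r; rw [QQ_integral]
    rw [this]
    have h3 := ((S.PB_joint f).comp measurable_swap).stronglyMeasurable
    exact (h3.integral_prod_right' (ν := S.QQ t x)).measurable
  have hIntg : Integrable (fun r => S.QB t (S.PB r f) x) (UU s) :=
    Integrable.of_bound hmeas.aestronglyMeasurable ‖f‖ (Eventually.of_forall fun r =>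
      (S.QB_abs t _ x).trans (S.PB_norm r f))
  have h1 : S.QB t (S.QB s f) x - S.QB t f x
      = ∫ r, (S.QB t (S.PB r f) x - S.QB t f x) ∂ UU s := by
    rw [QB_QB, integral_sub hIntg (integrable_const _)]
    simp
  rw [h1]
  have := norm_integral_le_of_norm_le_const (μ := UU s)
    (f := fun r => S.QB t (S.PB r f) x - S.QB t f x) (C := 2 * s * ‖f‖ / t) (by
      filter_upwards [UU_ae s] with r hr
      refine (S.QB_PB_sub ht hr.1.le f x).trans ?_
      have := hr.2
      gcongr)
  simpa using this

end aux

end MarkovFellerSemigroup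

namespace MarkovFellerSemigroup

open BoundedContinuousFunction ProbabilityTheory

section aux2

variable {X : Type*} [MetricSpace X] [MeasurableSpace X] [BorelSpace X]
  [TopologicalSpace.SeparableSpace X]

/-- Weak form of invariance. -/
def WInv (S : MarkovFellerSemigroup X) (μ : Measure X) : Prop :=
  ∀ (r : ℝ) (f : BoundedContinuousFunction X ℝ), 0 ≤ r → ∫ x, S.PB r f x ∂μ = ∫ x, f x ∂μ

theorem WInv.invariant {S : MarkovFellerSemigroup X} {μ : Measure X} [IsProbabilityMeasure μ]
    (h : S.WInv μ) : S.Invariant μ := by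
  refine ⟨inferInstance, fun t ht => ?_⟩
  haveI : IsProbabilityMeasure (S.Pmeas t μ) := by
    constructor
    rw [Pmeas, Measure.bind_apply MeasurableSet.univ (S.measurable_x t ht).aemeasurable]
    have : ∀ x, S.P t x univ = 1 := fun x => (S.isProb t ht x).measure_univ
    simp [this]
  refine ext_of_forall_integral_eq_of_IsFiniteMeasure fun f => ?_
  rw [Pmeas, aux_integral_bind μ (S.P t) (S.measurable_x t ht) (S.isProb t ht) f
    f.continuous.measurable ‖f‖ (fun y => f.norm_coe_le_norm y), ← h t f ht]
  simp only [PB_apply, PP, max_eq_left ht]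

theorem WInv.QB {S : MarkovFellerSemigroup X} {μ : Measure X} [IsProbabilityMeasure μ]
    (h : S.WInv μ) {t : ℝ} (ht : 0 < t) (f : BoundedContinuousFunction X ℝ) :
    ∫ x, S.QB t f x ∂μ = ∫ x, f x ∂μ := by
  haveI := UU_prob ht
  rw [QB_fubini]
  have : ∫ s, ∫ x, S.PB s f x ∂μ ∂ UU t = ∫ s, (∫ x, f x ∂μ) ∂ UU t := by
    refine integral_congr_ae ?_
    filter_upwards [UU_ae t] with s hs
    exact h s f hs.1.le
  rw [this]; simp

theorem aux_jensen (m : Measure X) [IsProbabilityMeasure m] (f : BoundedContinuousFunction X ℝ) :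
    (∫ x, f x ∂m) ^ 2 ≤ ∫ x, (f * f) x ∂m := by
  set c := ∫ x, f x ∂m with hc
  have h0 : 0 ≤ ∫ x, (f x - c) ^ 2 ∂m := integral_nonneg fun x => sq_nonneg _
  have h1 : ∫ x, (f x - c) ^ 2 ∂m = ∫ x, (((f * f) x - (2 * c) * f x) + c ^ 2) ∂m := by
    congr 1; funext x
    simp only [BoundedContinuousFunction.coe_mul, Pi.mul_apply]; ring
  have i1 : Integrable (fun x => (f * f) x - (2 * c) * f x) m :=
    ((f * f).integrable m).sub ((f.integrable m).const_mul _)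
  rw [integral_add i1 (integrable_const _), integral_sub ((f * f).integrable m) ((f.integrable m).const_mul _),
    integral_const_mul, ← hc] at h1
  simp only [integral_const, probReal_univ, one_smul] at h1
  nlinarith

theorem QB_sq (S : MarkovFellerSemigroup X) {μ : Measure X} [IsProbabilityMeasure μ]
    (h : S.WInv μ) {t : ℝ} (ht : 0 < t) (g : BoundedContinuousFunction X ℝ) :
    ∫ x, (S.QB t g x) ^ 2 ∂μ ≤ ∫ x, (g x) ^ 2 ∂μ := by
  have e : ∫ x, (g x) ^ 2 ∂μ = ∫ x, (g * g) x ∂μ := by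
    congr 1; funext x; simp [sq]
  rw [e, ← h.QB ht (g * g)]
  have e2 : (fun x => (S.QB t g x) ^ 2) = fun x => (S.QB t g * S.QB t g) x := by
    funext x; simp [sq]
  rw [e2]
  refine integral_mono ((S.QB t g * S.QB t g).integrable μ) ((S.QB t (g * g)).integrable μ) ?_
  intro x
  haveI := S.QQ_prob ht x
  have := aux_jensen (S.QQ t x) g
  rw [QQ_integral, QQ_integral] at this
  simpa [sq] using this

theorem QB_add (S : MarkovFellerSemigroup X) (t : ℝ) (f g : BoundedContinuousFunction X ℝ) (x : X) :
    S.QB t (f + g) x = S.QB t f x + S.QB t g x := by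
  haveI : IsFiniteMeasure (S.QQ t x) := by
    constructor
    rw [QQ_apply _ _ _ MeasurableSet.univ]
    simp
  simp only [← QQ_integral]
  exact integral_add (f.integrable _) (g.integrable _)

theorem QB_smul (S : MarkovFellerSemigroup X) (t : ℝ) (c : ℝ)
    (f : BoundedContinuousFunction X ℝ) (x : X) :
    S.QB t (c • f) x = c * S.QB t f x := by
  simp only [← QQ_integral]
  exact integral_const_mul _ _

/-- Functions with asymptotically the same averages as `f`. -/
def KK (S : MarkovFellerSemigroup X) (f : BoundedContinuousFunction X ℝ) :
    Set (BoundedContinuousFunction X ℝ) :=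
  {g | ∀ ε > (0:ℝ), ∃ T > (0:ℝ), ∀ t ≥ T, ∀ x, |S.QB t g x - S.QB t f x| ≤ ε}

theorem KK_QB (S : MarkovFellerSemigroup X) (f : BoundedContinuousFunction X ℝ) {s : ℝ}
    (hs : 0 < s) : S.QB s f ∈ S.KK f := by
  intro ε hε
  refine ⟨2 * s * ‖f‖ / ε + 1, by positivity, fun t ht x => ?_⟩
  have htp : 0 < t := lt_of_lt_of_le (by positivity) ht
  refine (S.QB_QB_sub hs htp f x).trans ?_
  rw [div_le_iff₀ htp]
  have : 2 * s * ‖f‖ / ε ≤ t := by linarith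
  rw [div_le_iff₀ hε] at this
  linarith

theorem KK_mid (S : MarkovFellerSemigroup X) (f : BoundedContinuousFunction X ℝ)
    {g h : BoundedContinuousFunction X ℝ} (hg : g ∈ S.KK f) (hh : h ∈ S.KK f) :
    ((1:ℝ) / 2) • (g + h) ∈ S.KK f := by
  intro ε hε
  obtain ⟨T1, hT1, h1⟩ := hg ε hε
  obtain ⟨T2, hT2, h2⟩ := hh ε hε
  refine ⟨max T1 T2, lt_max_of_lt_left hT1, fun t ht x => ?_⟩
  have a := abs_le.1 (h1 t ((le_max_left _ _).trans ht) x)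
  have b := abs_le.1 (h2 t ((le_max_right _ _).trans ht) x)
  rw [QB_smul, QB_add, abs_le]
  constructor <;> linarith [a.1, a.2, b.1, b.2]

theorem QB_L2_cauchy (S : MarkovFellerSemigroup X) {μ : Measure X} [IsProbabilityMeasure μ]
    (h : S.WInv μ) (f : BoundedContinuousFunction X ℝ) (ε : ℝ) (hε : 0 < ε) :
    ∃ T > (0:ℝ), ∀ s ≥ T, ∀ t ≥ T, ∫ x, (S.QB s f x - S.QB t f x) ^ 2 ∂μ ≤ ε := by
  let E : BoundedContinuousFunction X ℝ → ℝ := fun g => ∫ x, (g x) ^ 2 ∂μ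
  have hIntg : ∀ g : BoundedContinuousFunction X ℝ, Integrable (fun x => (g x) ^ 2) μ := by
    intro g
    have : (fun x => (g x) ^ 2) = fun x => (g * g) x := by funext x; simp [sq]
    rw [this]; exact (g * g).integrable μ
  have hE0 : ∀ g, 0 ≤ E g := fun g => integral_nonneg fun x => sq_nonneg _
  let m := sInf (E '' S.KK f)
  have hbdd : BddBelow (E '' S.KK f) := ⟨0, by rintro _ ⟨g, _, rfl⟩; exact hE0 g⟩
  have hm : ∀ g ∈ S.KK f, m ≤ E g := fun g hg => csInf_le hbdd ⟨g, hg, rfl⟩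
  have hne : (E '' S.KK f).Nonempty := ⟨_, S.QB 1 f, S.KK_QB f one_pos, rfl⟩
  -- energy of averages is eventually at most `m + η`
  have key : ∀ η > (0:ℝ), ∃ T > (0:ℝ), ∀ t ≥ T, E (S.QB t f) ≤ m + η := by
    intro η hη
    obtain ⟨_, ⟨g, hg, rfl⟩, hgm⟩ := exists_lt_of_csInf_lt hne
      (show sInf (E '' S.KK f) < m + η / 2 by linarith [show m = sInf (E '' S.KK f) from rfl])
    set c := ‖g‖ + ‖f‖ with hc
    have hc0 : 0 ≤ c := by positivity
    obtain ⟨T, hT, hTt⟩ := hg (η / (2 * (c + 1))) (by positivity)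
    refine ⟨T, hT, fun t ht => ?_⟩
    have htp : 0 < t := lt_of_lt_of_le hT ht
    have h1 : E (S.QB t f) ≤ E (S.QB t g) + η / 2 := by
      have h2 : E (S.QB t f) ≤ ∫ x, ((S.QB t g x) ^ 2 + η / 2) ∂μ := by
        refine integral_mono (hIntg _) ((hIntg _).add (integrable_const _)) fun x => ?_
        have a := hTt t ht x
        have b := S.QB_abs t g x
        have b' := S.QB_abs t f x
        have h3 : (S.QB t f x) ^ 2 - (S.QB t g x) ^ 2
            ≤ |S.QB t g x - S.QB t f x| * |S.QB t g x + S.QB t f x| := by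
          rw [← abs_mul]
          refine le_trans (le_of_eq ?_) (neg_le_abs _)
          ring
        have h4 : |S.QB t g x + S.QB t f x| ≤ c := (abs_add_le _ _).trans (add_le_add b b')
        have h5 : |S.QB t g x - S.QB t f x| * |S.QB t g x + S.QB t f x|
            ≤ η / (2 * (c + 1)) * (c + 1) :=
          mul_le_mul a (by linarith) (abs_nonneg _) (by positivity)
        have h6 : η / (2 * (c + 1)) * (c + 1) = η / 2 := by field_simp
        change (S.QB t f x) ^ 2 ≤ (S.QB t g x) ^ 2 + η / 2
        linarith
      rw [integral_add (hIntg _) (integrable_const _)] at h2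
      simpa using h2
    have h2 : E (S.QB t g) ≤ E g := S.QB_sq h htp g
    linarith
  obtain ⟨T, hT, hTt⟩ := key (ε / 4) (by positivity)
  refine ⟨T, hT, fun s hs t ht => ?_⟩
  have hsp : 0 < s := lt_of_lt_of_le hT hs
  have htp : 0 < t := lt_of_lt_of_le hT ht
  have hmid := hm _ (S.KK_mid f (S.KK_QB f hsp) (S.KK_QB f htp))
  have hpar : ∫ x, (S.QB s f x - S.QB t f x) ^ 2 ∂μ
      = 2 * E (S.QB s f) + 2 * E (S.QB t f) - 4 * E (((1:ℝ) / 2) • (S.QB s f + S.QB t f)) := by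
    simp only [E]
    have i1 : Integrable (fun x => 2 * (S.QB s f x) ^ 2 + 2 * (S.QB t f x) ^ 2) μ :=
      ((hIntg _).const_mul _).add ((hIntg _).const_mul _)
    rw [← integral_const_mul, ← integral_const_mul, ← integral_const_mul,
      ← integral_add ((hIntg _).const_mul _) ((hIntg _).const_mul _),
      ← integral_sub i1 ((hIntg _).const_mul _)]
    congr 1; funext x
    simp only [BoundedContinuousFunction.coe_smul, BoundedContinuousFunction.coe_add,
      Pi.add_apply, smul_eq_mul]
    ring
  rw [hpar]
  linarith [hTt s hs, hTt t ht]

/-- Pointwise consequence of Cesàro eventual continuity. -/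
theorem cec_eps (S : MarkovFellerSemigroup X) {z : X} (hz : S.CesaroEvContAt z)
    (f : BoundedContinuousFunction X ℝ) (hf : ∃ K, LipschitzWith K f) {ε : ℝ} (hε : 0 < ε) :
    ∃ δ > (0:ℝ), ∀ y ∈ ball z δ, ∃ T > (0:ℝ), ∀ t ≥ T, |S.QB t f y - S.QB t f z| ≤ ε := by
  have h := hz f ⟨hf, ‖f‖, fun x => f.norm_coe_le_norm x⟩
  have hb : ∀ y, ∀ᶠ t in atTop, |S.Qf t f y - S.Qf t f z| ≤ 2 * ‖f‖ := by
    intro y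
    filter_upwards [eventually_gt_atTop 0] with t ht
    rw [Qf_eq _ ht, Qf_eq _ ht]
    refine (abs_sub _ _).trans ?_
    linarith [S.QB_abs t f y, S.QB_abs t f z]
  have hbu : ∀ y, IsBoundedUnder (· ≤ ·) atTop fun t => |S.Qf t f y - S.Qf t f z| := fun y =>
    ⟨2 * ‖f‖, by simpa using hb y⟩
  have hbl : ∀ y, IsBoundedUnder (· ≥ ·) atTop fun t => |S.Qf t f y - S.Qf t f z| := fun y =>
    ⟨0, by simp⟩
  have hlim : ∀ᶠ y in 𝓝 z, limsup (fun t => |S.Qf t f y - S.Qf t f z|) atTop < ε := by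
    refine eventually_lt_of_limsup_lt (by rw [h]; exact hε) ?_
    refine ⟨2 * ‖f‖, ?_⟩
    simp only [eventually_map]
    refine Eventually.of_forall fun y => ?_
    exact limsup_le_of_le (hbl y).isCoboundedUnder_le (hb y)
  obtain ⟨δ, hδ, hball⟩ := Metric.eventually_nhds_iff_ball.1 hlim
  refine ⟨δ, hδ, fun y hy => ?_⟩
  have h2 := eventually_lt_of_limsup_lt (hball y hy) (hbu y)
  obtain ⟨T, hT⟩ := eventually_atTop.1 h2
  refine ⟨max T 1, lt_max_of_lt_right one_pos, fun t ht => ?_⟩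
  have htp : 0 < t := lt_of_lt_of_le (lt_max_of_lt_right one_pos) ht
  have := hT t ((le_max_left _ _).trans ht)
  rw [Qf_eq _ htp, Qf_eq _ htp] at this
  exact this.le

theorem QB_tendsto_supp (S : MarkovFellerSemigroup X) {μ : Measure X} [IsProbabilityMeasure μ]
    (h : S.WInv μ) (f : BoundedContinuousFunction X ℝ) (hf : ∃ K, LipschitzWith K f)
    {z : X} (hz : S.CesaroEvContAt z) (hs : z ∈ msupp μ) :
    ∃ l, Tendsto (fun t => S.QB t f z) atTop (𝓝 l) := by
  refine cauchySeq_tendsto_of_complete (Metric.cauchySeq_iff.2 fun ε hε => ?_)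
  obtain ⟨δ, hδ, hball⟩ := S.cec_eps hz f hf (show 0 < ε / 4 by positivity)
  let B : ℕ → Set X := fun n => {y | ∀ t ≥ (n:ℝ), |S.QB t f y - S.QB t f z| ≤ ε / 4}
  have hcov : ball z δ ⊆ ⋃ n, B n := by
    intro y hy
    obtain ⟨T, -, hT⟩ := hball y hy
    obtain ⟨n, hn⟩ := exists_nat_ge T
    exact mem_iUnion.2 ⟨n, fun t ht => hT t (hn.trans ht)⟩
  obtain ⟨n, hn⟩ : ∃ n, 0 < μ (B n) := by
    by_contra hcon
    push Not at hcon
    have : μ (⋃ n, B n) = 0 := measure_iUnion_null fun n => le_antisymm (hcon n) (zero_le)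
    exact (hs δ hδ).ne' (measure_mono_null hcov this)
  have hnr : 0 < (μ (B n)).toReal := ENNReal.toReal_pos hn.ne' (measure_ne_top _ _)
  obtain ⟨T, hT, hTT⟩ := S.QB_L2_cauchy h f ((ε / 4) ^ 2 * (μ (B n)).toReal / 2) (by positivity)
  refine ⟨max T n, fun s hs' t ht' => ?_⟩
  have hsT := (le_max_left _ _).trans hs'
  have htT := (le_max_left _ _).trans ht'
  have hsn := (le_max_right _ _).trans hs'
  have htn := (le_max_right _ _).trans ht'
  by_contra hcon
  rw [Real.dist_eq, not_lt] at hcon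
  have hL := hTT s hsT t htT
  have hsub : B n ⊆ {y | (ε / 4) ^ 2 ≤ (S.QB s f y - S.QB t f y) ^ 2} := by
    intro y hy
    have a := hy s hsn
    have b := hy t htn
    have : ε / 4 ≤ |S.QB s f y - S.QB t f y| := by
      have e : |S.QB s f z - S.QB t f z| ≤ |S.QB s f y - S.QB s f z| +
          |S.QB s f y - S.QB t f y| + |S.QB t f y - S.QB t f z| := by
        have e1 : S.QB s f z - S.QB t f z = -(S.QB s f y - S.QB s f z) +
          (S.QB s f y - S.QB t f y) + (S.QB t f y - S.QB t f z) := by ring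
        rw [e1]
        refine (abs_add_le _ _).trans (add_le_add_left ((abs_add_le _ _).trans ?_) _)
        rw [abs_neg]
      linarith
    change (ε / 4) ^ 2 ≤ (S.QB s f y - S.QB t f y) ^ 2
    rw [← sq_abs (S.QB s f y - S.QB t f y)]
    gcongr
  have hIntg : Integrable (fun x => (S.QB s f x - S.QB t f x) ^ 2) μ := by
    have : (fun x => (S.QB s f x - S.QB t f x) ^ 2)
        = fun x => ((S.QB s f - S.QB t f) * (S.QB s f - S.QB t f)) x := by
      funext x; simp [sq]
    rw [this]; exact BoundedContinuousFunction.integrable μ _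
  have hmk := mul_meas_ge_le_integral_of_nonneg (μ := μ)
    (Eventually.of_forall fun x => sq_nonneg (S.QB s f x - S.QB t f x)) hIntg ((ε / 4) ^ 2)
  have hmono : (μ (B n)).toReal ≤ μ.real {y | (ε / 4) ^ 2 ≤ (S.QB s f y - S.QB t f y) ^ 2} :=
    ENNReal.toReal_mono (measure_ne_top _ _) (measure_mono hsub)
  have : (ε / 4) ^ 2 * (μ (B n)).toReal
      ≤ (ε / 4) ^ 2 * μ.real {y | (ε / 4) ^ 2 ≤ (S.QB s f y - S.QB t f y) ^ 2} := by gcongr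
  have hp : 0 < (ε / 4) ^ 2 * (μ (B n)).toReal := by positivity
  linarith

theorem msupp_compl_null (μ : Measure X) : μ (msupp μ)ᶜ = 0 := by
  haveI := UniformSpace.secondCountable_of_separable X
  refine measure_null_of_locally_null _ fun x hx => ?_
  simp only [msupp, mem_compl_iff, mem_ofPred_eq, not_forall, not_lt] at hx
  obtain ⟨ε, hε, h0⟩ := hx
  exact ⟨ball x ε, mem_nhdsWithin_of_mem_nhds (ball_mem_nhds x hε), le_antisymm h0 zero_le⟩

theorem msupp_closed (μ : Measure X) : IsClosed (msupp μ) := by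
  rw [← isOpen_compl_iff, Metric.isOpen_iff]
  intro x hx
  simp only [msupp, mem_compl_iff, mem_ofPred_eq, not_forall, not_lt] at hx
  obtain ⟨ε, hε, h0⟩ := hx
  refine ⟨ε, hε, fun y hy hy' => ?_⟩
  obtain ⟨δ, hδ, hsub⟩ := Metric.isOpen_iff.1 isOpen_ball y hy
  exact (hy' δ hδ).ne' (measure_mono_null hsub (le_antisymm h0 zero_le))

end aux2

end MarkovFellerSemigroup

namespace MarkovFellerSemigroup

open BoundedContinuousFunction ProbabilityTheory

section aux3

variable {X : Type*} [MetricSpace X] [MeasurableSpace X] [BorelSpace X]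
  [TopologicalSpace.SeparableSpace X]

theorem upper_bound (S : MarkovFellerSemigroup X) (h : ∀ z : X, S.CesaroEvContAt z) (x : X)
    {μ : Measure X} [IsProbabilityMeasure μ] (hinv : S.WInv μ) (l : Filter ℝ) [l.NeBot]
    (hl : l ≤ atTop)
    (hconv : ∀ f : BoundedContinuousFunction X ℝ,
      Tendsto (fun t => S.QB t f x) l (𝓝 (∫ y, f y ∂μ)))
    (f : BoundedContinuousFunction X ℝ) (hf : ∃ K, LipschitzWith K f)
    (u : ℕ → ℝ) (hu : Tendsto u atTop atTop) (ε : ℝ) (hε : 0 < ε) :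
    ∀ᶠ n in atTop, S.QB (u n) f x < (∫ y, f y ∂μ) + ε := by
  have hba : ∀ y, IsBoundedUnder (· ≤ ·) atTop fun n => S.QB (u n) f y := fun y =>
    ⟨‖f‖, by
      simp only [eventually_map]
      exact Eventually.of_forall fun n => (abs_le.1 (S.QB_abs (u n) f y)).2⟩
  have hbb : ∀ y, IsBoundedUnder (· ≥ ·) atTop fun n => S.QB (u n) f y := fun y =>
    ⟨-‖f‖, by
      simp only [eventually_map]
      exact Eventually.of_forall fun n => (abs_le.1 (S.QB_abs (u n) f y)).1⟩
  let g0 : X → ℝ := fun y => limsup (fun n => S.QB (u n) f y) atTop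
  have hup : ∀ y, ∀ c, g0 y < c → ∀ᶠ n in atTop, S.QB (u n) f y < c := fun y c hc =>
    eventually_lt_of_limsup_lt hc (hba y)
  have hle : ∀ y c, (∀ᶠ n in atTop, S.QB (u n) f y ≤ c) → g0 y ≤ c := fun y c hc =>
    limsup_le_of_le (hbb y).isCoboundedUnder_le hc
  have hcmp : ∀ y z η, (∀ᶠ n in atTop, S.QB (u n) f y ≤ S.QB (u n) f z + η) →
      g0 y ≤ g0 z + η := by
    intro y z η hh
    refine le_of_forall_pos_le_add fun κ hκ => hle _ _ ?_
    filter_upwards [hh, hup z (g0 z + κ) (by linarith)] with n h1 h2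
    linarith
  have hcont : Continuous g0 := by
    rw [Metric.continuous_iff]
    intro z η hη
    obtain ⟨δ, hδ, hball⟩ := S.cec_eps (h z) f hf (show 0 < η / 2 by positivity)
    refine ⟨δ, hδ, fun y hy => ?_⟩
    obtain ⟨T, -, hT⟩ := hball y hy
    have hev := hu.eventually_ge_atTop T
    have h1 := hcmp y z (η / 2) (by
      filter_upwards [hev] with n hn
      linarith [(abs_le.1 (hT (u n) hn)).2])
    have h2 := hcmp z y (η / 2) (by
      filter_upwards [hev] with n hn
      linarith [(abs_le.1 (hT (u n) hn)).1])
    rw [Real.dist_eq, abs_lt]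
    constructor <;> linarith
  have hgb : ∀ y, ‖g0 y‖ ≤ ‖f‖ := by
    intro y
    rw [Real.norm_eq_abs, abs_le]
    refine ⟨?_, hle y _ (Eventually.of_forall fun n => (abs_le.1 (S.QB_abs (u n) f y)).2)⟩
    by_contra hc
    push Not at hc
    obtain ⟨n, hn⟩ := (hup y _ hc).exists
    linarith [(abs_le.1 (S.QB_abs (u n) f y)).1]
  let g : BoundedContinuousFunction X ℝ :=
    BoundedContinuousFunction.ofNormedAddCommGroup g0 hcont ‖f‖ hgb
  have hg : ∀ y, g y = g0 y := fun _ => rfl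
  -- the integral of `g`
  have hgint : ∫ y, g y ∂μ = ∫ y, f y ∂μ := by
    have hae : ∀ᵐ y ∂μ, Tendsto (fun n => S.QB (u n) f y) atTop (𝓝 (g y)) := by
      have : ∀ᵐ y ∂μ, y ∈ msupp μ := msupp_compl_null μ
      filter_upwards [this] with y hy
      obtain ⟨c, hc⟩ := S.QB_tendsto_supp hinv f hf (h y) hy
      have hc' := hc.comp hu
      have : g y = c := hc'.limsup_eq
      rw [this]
      exact hc'
    have h1 := tendsto_integral_of_dominated_convergence (μ := μ) (fun _ => ‖f‖)
      (fun n => (S.QB (u n) f).continuous.measurable.aestronglyMeasurable) (integrable_const _)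
      (fun n => Eventually.of_forall fun y => S.QB_abs (u n) f y) hae
    have h2 : Tendsto (fun n => ∫ y, S.QB (u n) f y ∂μ) atTop (𝓝 (∫ y, f y ∂μ)) := by
      refine tendsto_const_nhds.congr' ?_
      filter_upwards [hu.eventually_gt_atTop 0] with n hn
      exact (hinv.QB hn f).symm
    exact tendsto_nhds_unique h1 h2
  -- sub-invariance
  have hsub : ∀ s > (0:ℝ), g x ≤ S.QB s g x := by
    intro s hs
    haveI := S.QQ_prob hs x
    have hG : Tendsto (fun n => ∫ y, max (S.QB (u n) f y - g y) 0 ∂ S.QQ s x) atTop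
        (𝓝 (∫ y, (0:ℝ) ∂ S.QQ s x)) := by
      refine tendsto_integral_of_dominated_convergence (fun _ => 2 * ‖f‖) ?_ (integrable_const _)
        ?_ ?_
      · intro n
        have : Continuous fun y => max (S.QB (u n) f y - g y) 0 := by fun_prop
        exact this.measurable.aestronglyMeasurable
      · intro n
        refine Eventually.of_forall fun y => ?_
        rw [Real.norm_eq_abs, abs_of_nonneg (le_max_right _ _)]
        refine max_le ?_ (by positivity)
        have a := (abs_le.1 (S.QB_abs (u n) f y)).2
        have b := (abs_le.1 (hgb y)).1
        rw [hg]; linarith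
      · refine Eventually.of_forall fun y => ?_
        rw [Metric.tendsto_nhds]
        intro η hη
        filter_upwards [hup y (g0 y + η) (by linarith)] with n hn
        rw [Real.dist_eq, sub_zero, abs_of_nonneg (le_max_right _ _)]
        refine max_lt ?_ hη
        rw [hg]; linarith
    rw [integral_zero] at hG
    refine le_of_forall_pos_le_add fun η hη => ?_
    refine hle x _ ?_
    have hsm : Tendsto (fun n => 2 * s * ‖f‖ / u n) atTop (𝓝 0) :=
      tendsto_const_nhds.div_atTop hu
    filter_upwards [hu.eventually_gt_atTop 0, hG.eventually_lt_const (show 0 < η / 2 by positivity),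
      hsm.eventually_lt_const (show 0 < η / 2 by positivity)] with n hn h1 h2
    have h3 := (abs_le.1 (S.QB_QB_sub hs hn f x)).1
    rw [QB_comm, ← QQ_integral] at h3
    have h4 : ∫ y, S.QB (u n) f y ∂ S.QQ s x
        ≤ ∫ y, (g y + max (S.QB (u n) f y - g y) 0) ∂ S.QQ s x := by
      have ic : Continuous fun y => max (S.QB (u n) f y - g y) 0 := by fun_prop
      have ii : Integrable (fun y => max (S.QB (u n) f y - g y) 0) (S.QQ s x) :=
        ((((S.QB (u n) f).integrable (S.QQ s x)).sub (g.integrable (S.QQ s x))).pos_part)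
      refine integral_mono ((S.QB (u n) f).integrable _) ((g.integrable _).add ii) fun y => ?_
      change S.QB (u n) f y ≤ g y + max (S.QB (u n) f y - g y) 0
      linarith [le_max_left (S.QB (u n) f y - g y) 0]
    have ii : Integrable (fun y => max (S.QB (u n) f y - g y) 0) (S.QQ s x) :=
      ((((S.QB (u n) f).integrable (S.QQ s x)).sub (g.integrable (S.QQ s x))).pos_part)
    rw [integral_add (g.integrable _) ii, QQ_integral S s x g] at h4
    linarith
  have hfin : g x ≤ ∫ y, g y ∂μ := by
    refine ge_of_tendsto (hconv g) ?_
    filter_upwards [hl (eventually_gt_atTop 0)] with s hs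
    exact hsub s hs
  refine hup x _ ?_
  rw [← hg, ← hgint]
  linarith

theorem QB_neg (S : MarkovFellerSemigroup X) (t : ℝ)
    (f : BoundedContinuousFunction X ℝ) (x : X) :
    S.QB t (-f) x = - S.QB t f x := by
  simp only [← QQ_integral]
  exact integral_neg _

theorem exists_limit (S : MarkovFellerSemigroup X) (h : ∀ z : X, S.CesaroEvContAt z) (x : X)
    (hx : x ∈ S.Tset) :
    ∃ μ : Measure X, IsProbabilityMeasure μ ∧ S.Invariant μ ∧ S.QWeakLim x μ := by
  have hpos : ∀ t : ℝ, 0 < max t 1 := fun t => lt_max_of_lt_right one_pos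
  let q : ℝ → ProbabilityMeasure X := fun t => ⟨S.QQ (max t 1) x, S.QQ_prob (hpos t) x⟩
  have hq : ∀ t, 1 ≤ t → ∀ f : BoundedContinuousFunction X ℝ,
      ∫ y, f y ∂ (q t : Measure X) = S.QB t f x := by
    intro t ht f
    change ∫ y, f y ∂ (S.QQ (max t 1) x) = _
    rw [max_eq_left ht, QQ_integral]
  have htight : IsTightMeasureSet {((ν : ProbabilityMeasure X) : Measure X) | ν ∈ range q} := by
    rw [isTightMeasureSet_iff_exists_isCompact_measure_compl_le]
    intro ε hε
    obtain ⟨ε', hε', hle⟩ : ∃ ε' : ℝ, 0 < ε' ∧ ENNReal.ofReal ε' ≤ ε := by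
      rcases eq_or_ne ε ⊤ with rfl | hne
      · exact ⟨1, one_pos, le_top⟩
      · exact ⟨ε.toReal, ENNReal.toReal_pos hε.ne' hne, by rw [ENNReal.ofReal_toReal hne]⟩
    obtain ⟨K, hK, hKt⟩ := hx ε' hε'
    refine ⟨K, hK, ?_⟩
    rintro _ ⟨_, ⟨t, rfl⟩, rfl⟩
    have h1 := hKt _ (hpos t)
    rw [S.QQ_Qmeas (hpos t) x hK.measurableSet] at h1
    haveI := S.QQ_prob (hpos t) x
    change S.QQ (max t 1) x Kᶜ ≤ ε
    refine le_trans ?_ hle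
    rw [← ofReal_measureReal, probReal_compl_eq_one_sub hK.measurableSet]
    exact ENNReal.ofReal_le_ofReal (by linarith)
  have hcomp := isCompact_closure_of_isTightMeasureSet htight
  let 𝒰 : Ultrafilter ℝ := Ultrafilter.of atTop
  have h𝒰 : (𝒰 : Filter ℝ) ≤ atTop := Ultrafilter.of_le _
  obtain ⟨μ, -, hμ⟩ := hcomp.ultrafilter_le_nhds (𝒰.map q) (by
    rw [le_principal_iff]
    exact Filter.mem_map.2 (Eventually.of_forall fun t => subset_closure ⟨t, rfl⟩))
  have hμ' : Tendsto q 𝒰 (𝓝 μ) := hμ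
  rw [ProbabilityMeasure.tendsto_iff_forall_integral_tendsto] at hμ'
  have hconv : ∀ f : BoundedContinuousFunction X ℝ,
      Tendsto (fun t => S.QB t f x) 𝒰 (𝓝 (∫ y, f y ∂ (μ : Measure X))) := by
    intro f
    refine (hμ' f).congr' ?_
    filter_upwards [h𝒰 (eventually_ge_atTop 1)] with t ht
    exact hq t ht f
  have hinv : S.WInv (μ : Measure X) := by
    intro r f hr
    have h1 := hconv (S.PB r f)
    have h2 := hconv f
    have h3 : Tendsto (fun t => S.QB t (S.PB r f) x - S.QB t f x) 𝒰 (𝓝 0) := by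
      have hsm : Tendsto (fun t : ℝ => 2 * r * ‖f‖ / t) 𝒰 (𝓝 0) :=
        (tendsto_const_nhds.div_atTop tendsto_id).mono_left h𝒰
      refine squeeze_zero_norm' ?_ hsm
      filter_upwards [h𝒰 (eventually_gt_atTop 0)] with t ht
      exact S.QB_PB_sub ht hr f x
    have h4 := tendsto_nhds_unique (h1.sub h2) h3
    linarith
  have hlip : ∀ f : BoundedContinuousFunction X ℝ, (∃ K, LipschitzWith K f) →
      Tendsto (fun t => S.QB t f x) atTop (𝓝 (∫ y, f y ∂ (μ : Measure X))) := by
    intro f hf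
    refine tendsto_of_seq_tendsto fun u hu => ?_
    have hf' : ∃ K, LipschitzWith K (-f : BoundedContinuousFunction X ℝ) := by
      obtain ⟨K, hK⟩ := hf
      exact ⟨K, hK.neg⟩
    rw [Metric.tendsto_nhds]
    intro ε hε
    have h1 := S.upper_bound h x hinv 𝒰 h𝒰 hconv f hf u hu ε hε
    have h2 := S.upper_bound h x hinv 𝒰 h𝒰 hconv (-f) hf' u hu ε hε
    have h5 : ∫ y, (-f : BoundedContinuousFunction X ℝ) y ∂ (μ : Measure X)
        = - ∫ y, f y ∂ (μ : Measure X) := integral_neg _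
    filter_upwards [h1, h2] with n h3 h4
    rw [QB_neg, h5] at h4
    rw [Function.comp_apply, Real.dist_eq, abs_lt]
    constructor <;> linarith
  refine ⟨μ, inferInstance, hinv.invariant, ?_⟩
  have hw : Tendsto q atTop (𝓝 μ) := by
    rw [tendsto_iff_forall_lipschitz_integral_tendsto]
    rintro f ⟨C, hC⟩ ⟨L, hL⟩
    let F : BoundedContinuousFunction X ℝ := BoundedContinuousFunction.mkOfBound
      ⟨f, hL.continuous⟩ C hC
    refine (hlip F ⟨L, hL⟩).congr' ?_
    filter_upwards [eventually_ge_atTop 1] with t ht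
    exact (hq t ht F).symm
  rw [ProbabilityMeasure.tendsto_iff_forall_integral_tendsto] at hw
  intro f
  refine (hw f).congr' ?_
  filter_upwards [eventually_ge_atTop 1] with t ht
  rw [hq t ht, Qf_eq _ (by linarith)]

theorem QfM_eq (S : MarkovFellerSemigroup X) (μ : Measure X) [IsFiniteMeasure μ] {t : ℝ}
    (ht : 0 < t) (f : BoundedContinuousFunction X ℝ) : S.QfM t f μ = ∫ x, S.QB t f x ∂μ := by
  rw [QB_fubini, UU_integral ht, QfM]
  congr 1
  refine intervalIntegral.integral_congr fun s hs => ?_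
  rw [uIcc_of_le ht.le] at hs
  simp only [PB_apply, PP, max_eq_left hs.1, Pf]

end aux3

end MarkovFellerSemigroup


namespace MarkovFellerSemigroup

variable {X : Type*} [MetricSpace X] [CompleteSpace X]
  [TopologicalSpace.SeparableSpace X] [MeasurableSpace X] [BorelSpace X]

theorem cesaro_weak_convergence_on_Tset (S : MarkovFellerSemigroup X)
    (h : ∀ z : X, S.CesaroEvContAt z) :
    ∃ e : X → Measure X,
      (∀ x ∈ S.Tset, S.Invariant (e x) ∧ S.QWeakLim x (e x)) ∧
      ∀ μ : Measure X, IsProbabilityMeasure μ → msupp μ ⊆ S.Tset →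
        ∃ ν : Measure X,
          (∀ A : Set X, MeasurableSet A → ν A = ∫⁻ x in S.Tset, e x A ∂μ) ∧
          S.Invariant ν ∧ S.QWeakLimM μ ν := by
  classical
  have hex : ∀ x, ∃ m : Measure X, IsProbabilityMeasure m ∧
      (x ∈ S.Tset → S.Invariant m ∧ S.QWeakLim x m) := by
    intro x
    by_cases hx : x ∈ S.Tset
    · obtain ⟨m, hm, h1, h2⟩ := S.exists_limit h x hx
      exact ⟨m, hm, fun _ => ⟨h1, h2⟩⟩
    · exact ⟨Measure.dirac x, inferInstance, fun h => absurd h hx⟩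
  choose e he hlim using hex
  refine ⟨e, hlim, fun μ hμ hsupp => ?_⟩
  have hcl : MeasurableSet (msupp μ) := (msupp_closed μ).measurableSet
  have hae : ∀ᵐ x ∂μ, x ∈ msupp μ := msupp_compl_null μ
  let e' : X → Measure X := fun x => if x ∈ msupp μ then e x else Measure.dirac x
  have he' : ∀ x, IsProbabilityMeasure (e' x) := by
    intro x
    by_cases hx : x ∈ msupp μ
    · simp only [e', hx, if_true]; exact he x
    · simp only [e', hx, if_false]; infer_instance
  have hee : ∀ x ∈ msupp μ, e' x = e x := fun x hx => by simp only [e', hx, if_true]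
  have hptw : ∀ x ∈ msupp μ, ∀ f : BoundedContinuousFunction X ℝ,
      Tendsto (fun t => S.QB t f x) atTop (𝓝 (∫ y, f y ∂ e' x)) := by
    intro x hx f
    rw [hee x hx]
    refine ((hlim x (hsupp hx)).2 f).congr' ?_
    filter_upwards [eventually_gt_atTop 0] with t ht
    exact S.Qf_eq ht f x
  have hmeas : Measurable e' := by
    refine aux_measurable_of_integrals e' he' fun f => ?_
    refine measurable_of_tendsto_metrizable
      (f := fun (n : ℕ) x => if x ∈ msupp μ then S.QB (n : ℝ) f x else f x)
      (fun n => Measurable.ite hcl (S.QB (n : ℝ) f).continuous.measurable f.continuous.measurable)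
      (tendsto_pi_nhds.2 fun x => ?_)
    by_cases hx : x ∈ msupp μ
    · simp only [hx, if_true]
      exact (hptw x hx f).comp tendsto_natCast_atTop_atTop
    · simp only [hx, if_false, e']
      rw [integral_dirac]
      exact tendsto_const_nhds
  have hTae : S.Tset =ᵐ[μ] univ := by
    rw [eventuallyEq_univ]
    exact hae.mono fun x hx => hsupp hx
  have hνp : IsProbabilityMeasure (μ.bind e') := by
    constructor
    rw [Measure.bind_apply MeasurableSet.univ hmeas.aemeasurable]
    simp
  refine ⟨μ.bind e', ?_, ⟨hνp, ?_⟩, ?_⟩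
  · intro A hA
    rw [Measure.bind_apply hA hmeas.aemeasurable, Measure.restrict_congr_set hTae,
      Measure.restrict_univ]
    refine lintegral_congr_ae ?_
    filter_upwards [hae] with x hx
    rw [hee x hx]
  · intro t ht
    rw [Pmeas, Measure.bind_bind hmeas.aemeasurable (S.measurable_x t ht).aemeasurable]
    refine Measure.bind_congr_right ?_
    filter_upwards [hae] with x hx
    rw [hee x hx]
    exact (hlim x (hsupp hx)).1.2 t ht
  · intro f
    rw [aux_integral_bind μ e' hmeas he' f f.continuous.measurable ‖f‖
      (fun y => f.norm_coe_le_norm y)]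
    have h1 : Tendsto (fun t => ∫ x, S.QB t f x ∂μ) atTop (𝓝 (∫ x, ∫ y, f y ∂ e' x ∂μ)) := by
      refine tendsto_integral_filter_of_dominated_convergence (fun _ => ‖f‖) ?_ ?_
        (integrable_const _) ?_
      · exact Eventually.of_forall fun t =>
          (S.QB t f).continuous.measurable.aestronglyMeasurable
      · exact Eventually.of_forall fun t => Eventually.of_forall fun x => S.QB_abs t f x
      · filter_upwards [hae] with x hx
        exact hptw x hx f
    refine h1.congr' ?_
    filter_upwards [eventually_gt_atTop 0] with t ht
    exact (S.QfM_eq μ ht f).symm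

end MarkovFellerSemigroup
end

section
/- If a Markov–Feller semigroup (P_t)_{t≥0} on a Polish space X is weakly-* mean ergodic, then it is Cesàro eventually continuous at every point of X. -/
open MeasureTheory Filter Metric Set Topology
open scoped ENNReal

namespace MarkovFellerSemigroup

variable {X : Type*} [MetricSpace X] [CompleteSpace X]
  [TopologicalSpace.SeparableSpace X] [MeasurableSpace X] [BorelSpace X]

/-- Weak-* mean ergodicity: there is a unique invariant probability measure `μ*`
and `Q_t μ` converges weakly to `μ*` for every probability measure `μ`. -/
def WeakStarMeanErgodic (S : MarkovFellerSemigroup X) : Prop :=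
  ∃ μs : Measure X, S.Invariant μs ∧ (∀ ν : Measure X, S.Invariant ν → ν = μs) ∧
    ∀ μ : Measure X, IsProbabilityMeasure μ → S.QWeakLimM μ μs

theorem cesaroEvContAt_of_weakStarMeanErgodic (S : MarkovFellerSemigroup X)
    (h : S.WeakStarMeanErgodic) : ∀ z : X, S.CesaroEvContAt z := by
  obtain ⟨μs, -, -, hconv⟩ := h
  intro z f hf
  obtain ⟨⟨K, hK⟩, M, hM⟩ := hf
  let F : BoundedContinuousFunction X ℝ :=
    BoundedContinuousFunction.ofNormedAddCommGroup f hK.continuous M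
      (fun x => by simpa [Real.norm_eq_abs] using hM x)
  have hlim : ∀ x, Tendsto (fun t => S.Qf t f x) atTop (𝓝 (∫ y, f y ∂μs)) := by
    intro x
    have h1 := hconv (Measure.dirac x) inferInstance F
    have h2 : (fun t => S.QfM t F (Measure.dirac x)) = fun t => S.Qf t f x := by
      funext t
      simp only [QfM, Qf, integral_dirac]
      rfl
    rw [h2] at h1
    exact h1
  have hz : ∀ x, limsup (fun t => |S.Qf t f x - S.Qf t f z|) atTop = 0 := by
    intro x
    have h3 := ((hlim x).sub (hlim z)).abs
    simp only [sub_self, abs_zero] at h3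
    exact h3.limsup_eq
  simp only [hz]
  exact tendsto_const_nhds.limsup_eq

end MarkovFellerSemigroup
end

section
/- Let (P_t)_{t≥0} be a Markov–Feller semigroup on a Polish space X that is Cesàro eventually continuous on X, and let μ be an ergodic invariant probability measure for (P_t). Then for every x ∈ supp μ, the measures Q_t(x,·) converge weakly to μ as t → ∞. -/
open MeasureTheory Filter Metric Set Topology
open scoped ENNReal

namespace MarkovFellerSemigroup

section Aux

variable {X : Type*} [MetricSpace X] [MeasurableSpace X] [BorelSpace X]

open ProbabilityTheory

/-- A family of probability measures is measurable when its integrals of bounded continuous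
functions are. -/
theorem measurable_of_integral {α : Type*} [MeasurableSpace α] (κ : α → Measure X)
    [∀ a, IsProbabilityMeasure (κ a)]
    (hκ : ∀ f : BoundedContinuousFunction X ℝ, Measurable fun a => ∫ y, f y ∂ κ a) :
    Measurable κ := by
  refine Measurable.measure_of_isPiSystem_of_isProbabilityMeasure
    (S := {s | IsClosed s}) ?_ isPiSystem_isClosed ?_
  · rw [BorelSpace.measurable_eq (α := X), borel_eq_generateFrom_isClosed]
  · intro F hF
    have hF : IsClosed F := hF
    refine measurable_of_tendsto_metrizable (f := fun n a => ∫⁻ x, (hF.apprSeq n x : ℝ≥0∞) ∂ κ a)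
      (fun n => ?_) ?_
    · let g : BoundedContinuousFunction X ℝ :=
        ⟨⟨fun x => (hF.apprSeq n x : ℝ), by fun_prop⟩, (hF.apprSeq n).map_bounded'⟩
      have : (fun a => ∫⁻ x, (hF.apprSeq n x : ℝ≥0∞) ∂ κ a)
          = fun a => ENNReal.ofReal (∫ x, g x ∂ κ a) := by
        funext a
        have h1 := BoundedContinuousFunction.toReal_lintegral_coe_eq_integral (hF.apprSeq n) (κ a)
        change _ = ∫ x, g x ∂ κ a at h1
        rw [← h1, ENNReal.ofReal_toReal]
        exact (BoundedContinuousFunction.lintegral_lt_top_of_nnreal (κ a) _).ne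
      rw [this]
      exact (hκ g).ennreal_ofReal
    · rw [tendsto_pi_nhds]
      intro a
      exact HasOuterApproxClosed.tendsto_lintegral_apprSeq hF (κ a)

theorem integral_comp_kernel {α : Type*} [MeasurableSpace α] (κ : Kernel α X) [IsMarkovKernel κ]
    (ν : Measure α) [IsProbabilityMeasure ν] (f : BoundedContinuousFunction X ℝ) :
    ∫ y, f y ∂ (ν.bind κ) = ∫ a, ∫ y, f y ∂ κ a ∂ν := by
  have h : ν.bind κ = (κ ∘ₖ (Kernel.const Unit ν)) () := Measure.comp_eq_comp_const_apply
  have : IsProbabilityMeasure (ν.bind κ) := inferInstanceAs (IsProbabilityMeasure (κ ∘ₘ ν))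
  rw [h, Kernel.integral_comp]
  · simp
  · rw [← h]; exact f.integrable _

variable (S : MarkovFellerSemigroup X)

instance instProbMax (t : ℝ) (x : X) : IsProbabilityMeasure (S.P (max t 0) x) :=
  S.isProb _ (le_max_right _ _) x

/-- The kernel at a fixed time. -/
noncomputable def ker (t : ℝ) : Kernel X X := ⟨S.P (max t 0), S.measurable_x _ (le_max_right _ _)⟩

instance (t : ℝ) : IsMarkovKernel (S.ker t) := ⟨fun x => S.instProbMax t x⟩

theorem Pf_comp (r s : ℝ) (hr : 0 ≤ r) (hs : 0 ≤ s) (f : BoundedContinuousFunction X ℝ) (x : X) :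
    S.Pf s (S.Pf r f) x = S.Pf (s + r) f x := by
  have := S.isProb s hs x
  have h := integral_comp_kernel (S.ker r) (S.P s x) f
  simp only [ker, max_eq_left hr, Kernel.coe_mk] at h
  rw [← S.semigroup r s hr hs] at h
  exact h.symm

theorem abs_Pf_le (s : ℝ) (hs : 0 ≤ s) (f : BoundedContinuousFunction X ℝ) (x : X) :
    |S.Pf s f x| ≤ ‖f‖ := by
  have := S.isProb s hs x
  simpa [Pf] using f.norm_integral_le_norm (S.P s x)

/-- `P_r f` as a bounded continuous function. -/
noncomputable def PfB (r : ℝ) (hr : 0 ≤ r) (f : BoundedContinuousFunction X ℝ) :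
    BoundedContinuousFunction X ℝ :=
  BoundedContinuousFunction.ofNormedAddCommGroup (S.Pf r f) (S.feller f r hr) ‖f‖
    (fun x => S.abs_Pf_le r hr f x)

variable [TopologicalSpace.SeparableSpace X]

theorem measurable_joint (f : BoundedContinuousFunction X ℝ) :
    Measurable fun p : ℝ × X => S.Pf (max p.1 0) f p.2 := by
  have : SecondCountableTopology X := UniformSpace.secondCountable_of_separable X
  have h := measurable_uncurry_of_continuous_of_measurable
    (u := fun (x : X) (t : ℝ) => S.Pf (max t 0) f x)
    (fun t => S.feller f _ (le_max_right _ _))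
    (fun x => (S.measurable_t f x).comp (measurable_id.max measurable_const))
  exact h.comp measurable_swap

/-- The joint kernel. -/
noncomputable def jker : Kernel (ℝ × X) X :=
  ⟨fun p => S.P (max p.1 0) p.2, measurable_of_integral _ (fun f => S.measurable_joint f)⟩

instance : IsMarkovKernel S.jker := ⟨fun p => S.instProbMax p.1 p.2⟩

/-- Uniform time measure on `(0, max t 1]`. -/
noncomputable def tau (t : ℝ) : Measure ℝ := ProbabilityTheory.cond volume (Ioc 0 (max t 1))

instance (t : ℝ) : IsProbabilityMeasure (tau t) := by
  refine cond_isProbabilityMeasure_of_finite ?_ ?_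
  · simp
  · simp

theorem integral_tau {t : ℝ} (ht : 1 ≤ t) (g : ℝ → ℝ) :
    ∫ s, g s ∂ (tau t) = (1 / t) * ∫ s in (0:ℝ)..t, g s := by
  have h0 : 0 ≤ t := by linarith
  rw [tau, ProbabilityTheory.cond, integral_smul_measure, max_eq_left ht,
    intervalIntegral.integral_of_le h0]
  simp [ENNReal.toReal_ofReal h0]

theorem tau_nonneg (t : ℝ) : ∀ᵐ s ∂ (tau t), 0 ≤ s := by
  have : ∀ᵐ s ∂ (tau t), s ∈ Ioc 0 (max t 1) := by
    refine ae_cond_mem measurableSet_Ioc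
  filter_upwards [this] with s hs using hs.1.le

/-- `Q_t ν` as a measure. -/
noncomputable def Qnu (ν : Measure X) (t : ℝ) : Measure X := ((tau t).prod ν).bind S.jker

instance (ν : Measure X) [IsProbabilityMeasure ν] (t : ℝ) : IsProbabilityMeasure (S.Qnu ν t) :=
  inferInstanceAs (IsProbabilityMeasure (S.jker ∘ₘ ((tau t).prod ν)))

theorem integrable_joint (ν : Measure X) [IsProbabilityMeasure ν] (t : ℝ)
    (f : BoundedContinuousFunction X ℝ) :
    Integrable (fun p : ℝ × X => S.Pf (max p.1 0) f p.2) ((tau t).prod ν) := by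
  refine Integrable.of_bound (S.measurable_joint f).aestronglyMeasurable ‖f‖ ?_
  exact Eventually.of_forall fun p => S.abs_Pf_le _ (le_max_right _ _) f p.2

theorem Qf_eq_s6 {t : ℝ} (ht : 1 ≤ t) (f : X → ℝ) (x : X) :
    S.Qf t f x = ∫ s, S.Pf (max s 0) f x ∂ (tau t) := by
  rw [integral_tau ht, Qf]
  congr 1
  refine intervalIntegral.integral_congr (fun s hs => ?_)
  rw [uIcc_of_le (by linarith)] at hs
  simp [max_eq_left hs.1]

theorem integral_Qnu_time (ν : Measure X) [IsProbabilityMeasure ν] {t : ℝ}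
    (f : BoundedContinuousFunction X ℝ) :
    ∫ y, f y ∂ (S.Qnu ν t) = ∫ s, ∫ x, S.Pf (max s 0) f x ∂ν ∂(tau t) := by
  rw [Qnu, integral_comp_kernel, ← integral_prod _ (S.integrable_joint ν t f)]
  rfl

theorem integral_Qnu (ν : Measure X) [IsProbabilityMeasure ν] {t : ℝ} (ht : 1 ≤ t)
    (f : BoundedContinuousFunction X ℝ) :
    ∫ y, f y ∂ (S.Qnu ν t) = ∫ x, S.Qf t f x ∂ν := by
  simp_rw [S.Qf_eq_s6 ht]
  rw [Qnu, integral_comp_kernel, ← integral_prod_symm _ (S.integrable_joint ν t f)]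
  rfl

theorem abs_Qf_le {t : ℝ} (ht : 1 ≤ t) (f : BoundedContinuousFunction X ℝ) (x : X) :
    |S.Qf t f x| ≤ ‖f‖ := by
  rw [S.Qf_eq_s6 ht]
  have := norm_integral_le_of_norm_le_const (μ := tau t) (f := fun s => S.Pf (max s 0) f x)
    (C := ‖f‖) (Eventually.of_forall fun s => S.abs_Pf_le _ (le_max_right _ _) f x)
  simpa using this

theorem measurable_Qf {t : ℝ} (ht : 1 ≤ t) (f : BoundedContinuousFunction X ℝ) :
    StronglyMeasurable (S.Qf t f) := by
  have : S.Qf t f = fun x => ∫ s, S.Pf (max s 0) f x ∂ (tau t) := by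
    funext x; exact S.Qf_eq_s6 ht f x
  rw [this]
  exact ((S.measurable_joint f).stronglyMeasurable.comp_measurable
    measurable_swap).integral_prod_right' (ν := tau t)

theorem Qnu_le (ν μ : Measure X) [IsProbabilityMeasure ν] (hμ : S.Invariant μ) (a : ℝ≥0∞)
    (hν : a • ν ≤ μ) (t : ℝ) : a • S.Qnu ν t ≤ μ := by
  have := hμ.1
  refine Measure.le_iff.2 fun A hA => ?_
  have hm : Measurable fun p : ℝ × X => S.jker p A := Kernel.measurable_coe _ hA
  rw [Measure.smul_apply, Qnu, Measure.bind_apply hA (Kernel.aemeasurable _),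
    lintegral_prod _ hm.aemeasurable, smul_eq_mul, ← lintegral_const_mul _ hm.lintegral_prod_right']
  calc _ ≤ ∫⁻ s, μ A ∂ (tau t) := by
        refine lintegral_mono fun s => ?_
        have h1 := hμ.2 (max s 0) (le_max_right _ _)
        have h2 : μ A = ∫⁻ x, S.P (max s 0) x A ∂μ := by
          conv_lhs => rw [← h1, Pmeas]
          rw [Measure.bind_apply hA (S.measurable_x _ (le_max_right _ _)).aemeasurable]
        rw [h2, ← smul_eq_mul, ← lintegral_smul_measure]
        exact lintegral_mono' hν le_rfl
    _ = μ A := by simp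

theorem integral_Qnu_shift (ν : Measure X) [IsProbabilityMeasure ν] {t r : ℝ} (ht : 1 ≤ t)
    (hr : 0 ≤ r) (f : BoundedContinuousFunction X ℝ) :
    |∫ y, S.Pf r f y ∂ (S.Qnu ν t) - ∫ y, f y ∂ (S.Qnu ν t)| ≤ (2 * r * ‖f‖) / t := by
  have h1 := S.integral_Qnu_time ν (t := t) (S.PfB r hr f)
  have h2 := S.integral_Qnu_time ν (t := t) f
  change ∫ y, S.Pf r f y ∂ (S.Qnu ν t) = ∫ s, ∫ x, S.Pf (max s 0) (S.Pf r f) x ∂ν ∂(tau t) at h1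
  simp_rw [S.Pf_comp r _ hr (le_max_right _ _)] at h1
  set g : ℝ → ℝ := fun s => ∫ x, S.Pf (max s 0) f x ∂ν with hg
  have hgm : Measurable g :=
    ((S.measurable_joint f).stronglyMeasurable.integral_prod_right (ν := ν)).measurable
  have hgb : ∀ s, |g s| ≤ ‖f‖ := fun s => by
    have := norm_integral_le_of_norm_le_const (μ := ν) (f := fun x => S.Pf (max s 0) f x)
      (C := ‖f‖) (Eventually.of_forall fun x => S.abs_Pf_le _ (le_max_right _ _) f x)
    simpa using this
  have hgi : ∀ a b, IntervalIntegrable g volume a b := fun a b =>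
    (intervalIntegrable_const (c := ‖f‖)).mono_fun hgm.aestronglyMeasurable
      (Eventually.of_forall fun s => by simpa using hgb s)
  have h3 : ∫ y, S.Pf r f y ∂ (S.Qnu ν t) = ∫ s, g (s + r) ∂ (tau t) := by
    rw [h1]
    refine integral_congr_ae ?_
    filter_upwards [tau_nonneg t] with s hs
    simp [hg, max_eq_left hs, max_eq_left (add_nonneg hs hr)]
  rw [h3, h2, integral_tau ht, integral_tau ht, ← mul_sub,
    intervalIntegral.integral_comp_add_right, zero_add,
    intervalIntegral.integral_interval_sub_interval_comm' (hgi _ _) (hgi _ _) (hgi _ _)]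
  have e1 : |∫ s in t..t + r, g s| ≤ ‖f‖ * r := by
    have := intervalIntegral.norm_integral_le_of_norm_le_const (a := t) (b := t + r) (f := g)
      (C := ‖f‖) (fun s _ => hgb s)
    simpa [abs_of_nonneg hr] using this
  have e2 : |∫ s in (0:ℝ)..r, g s| ≤ ‖f‖ * r := by
    have := intervalIntegral.norm_integral_le_of_norm_le_const (a := 0) (b := r) (f := g)
      (C := ‖f‖) (fun s _ => hgb s)
    simpa [abs_of_nonneg hr] using this
  have ht0 : 0 < t := by linarith
  rw [abs_mul, abs_of_nonneg (by positivity : 0 ≤ 1 / t),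
    show 2 * r * ‖f‖ / t = 1 / t * (2 * r * ‖f‖) by ring]
  gcongr
  exact (abs_sub _ _).trans (by linarith)

/-- Extremality: an invariant measure dominated by a multiple of an ergodic one equals it. -/
theorem eq_of_smul_le (μ ν : Measure X) (hμ : S.ErgodicInv μ) (hν : S.Invariant ν) (a : ℝ≥0∞)
    (ha : a ≠ 0) (hle : a • ν ≤ μ) : ν = μ := by
  have := hμ.1.1
  have := hν.1
  have ha1 : a ≤ 1 := by simpa using hle univ
  have hat : a ≠ ∞ := (ha1.trans_lt ENNReal.one_lt_top).ne
  have : IsFiniteMeasure (a • ν) := isFiniteMeasure_of_le μ hle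
  have hadd : (μ - a • ν) + a • ν = μ := Measure.sub_add_cancel_of_le hle
  have bind_add : ∀ (t : ℝ), 0 ≤ t → ∀ m₁ m₂ : Measure X,
      S.Pmeas t (m₁ + m₂) = S.Pmeas t m₁ + S.Pmeas t m₂ := by
    intro t ht m₁ m₂
    have h := Measure.comp_add (κ := S.ker t) (μ := m₁) (ν := m₂)
    simpa [ker, max_eq_left ht, Pmeas] using h
  have bind_smul : ∀ (t : ℝ) (c : ℝ≥0∞) (m : Measure X),
      S.Pmeas t (c • m) = c • S.Pmeas t m := fun t c m => Measure.bind_smul c m _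
  set l : Measure X := μ - a • ν with hl
  have hlinv : ∀ t, 0 ≤ t → S.Pmeas t l = l := by
    intro t ht
    have h1 := hμ.1.2 t ht
    rw [← hadd, bind_add t ht, bind_smul, hν.2 t ht] at h1
    ext A hA
    have h2 := congrArg (fun m : Measure X => m A) h1
    simp only [Measure.add_apply] at h2
    exact (ENNReal.add_left_inj (measure_ne_top (a • ν) A)).1 h2
  have hlu : l univ + a = 1 := by
    have h2 := congrArg (fun m : Measure X => m univ) hadd
    simpa using h2
  have hb : a + (1 - a) = 1 := add_tsub_cancel_of_le ha1
  have hs : a • μ + (1 - a) • μ = μ := by rw [← add_smul, hb, one_smul]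
  have i1 : S.Invariant (a • ν + (1 - a) • μ) := by
    refine ⟨⟨by simpa using hb⟩, fun t ht => ?_⟩
    rw [bind_add t ht, bind_smul, bind_smul, hν.2 t ht, hμ.1.2 t ht]
  have i2 : S.Invariant (l + a • μ) := by
    refine ⟨⟨by simpa using hlu⟩, fun t ht => ?_⟩
    rw [bind_add t ht, bind_smul, hlinv t ht, hμ.1.2 t ht]
  have key := (hμ.2 _ _ i1 i2 ?_).1
  · ext A hA
    have h2 := congrArg (fun m : Measure X => m A) (key.trans hs.symm)
    simp only [Measure.add_apply] at h2
    have hfin : ((1 - a) • μ) A ≠ ∞ := by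
      simp only [Measure.smul_apply, smul_eq_mul]
      exact ENNReal.mul_ne_top (ne_top_of_le_ne_top ENNReal.one_ne_top tsub_le_self)
        (measure_ne_top μ A)
    have h3 := (ENNReal.add_left_inj hfin).1 h2
    simp only [Measure.smul_apply, smul_eq_mul] at h3
    exact (ENNReal.mul_right_inj ha hat).1 h3
  · have : a • ν + (1 - a) • μ + (l + a • μ) = (2 : ℝ≥0∞) • μ := by
      calc _ = (l + a • ν) + (a • μ + (1 - a) • μ) := by abel
        _ = μ + μ := by rw [hadd, hs]
        _ = _ := by rw [two_smul]
    rw [this, smul_smul, ENNReal.inv_mul_cancel two_ne_zero ENNReal.ofNat_ne_top, one_smul]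

/-- `Q_t ν` as a bundled probability measure. -/
noncomputable def QnuP (ν : Measure X) [IsProbabilityMeasure ν] (t : ℝ) : ProbabilityMeasure X :=
  ⟨S.Qnu ν t, inferInstance⟩

theorem tendsto_QnuP [CompleteSpace X] (μ ν : Measure X) [IsProbabilityMeasure ν]
    [IsProbabilityMeasure μ]
    (hμ : S.ErgodicInv μ) (a : ℝ≥0∞) (ha : a ≠ 0) (hle : a • ν ≤ μ) :
    Tendsto (S.QnuP ν) atTop (𝓝 ⟨μ, inferInstance⟩) := by
  have : SecondCountableTopology X := UniformSpace.secondCountable_of_separable X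
  have ha1 : a ≤ 1 := by simpa using hle univ
  have hat : a ≠ ∞ := (ha1.trans_lt ENNReal.one_lt_top).ne
  have hQ : ∀ t, a • S.Qnu ν t ≤ μ := fun t => S.Qnu_le ν μ hμ.1 a hle t
  have htight : IsCompact (closure (range (S.QnuP ν))) := by
    apply isCompact_closure_of_isTightMeasureSet
    rw [isTightMeasureSet_iff_exists_isCompact_measure_compl_le]
    intro ε hε
    obtain ⟨K, hK, hKμ⟩ := isTightMeasureSet_iff_exists_isCompact_measure_compl_le.1
      (isTightMeasureSet_singleton (μ := μ)) (a * ε) (pos_iff_ne_zero.2 (mul_ne_zero ha hε.ne'))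
    refine ⟨K, hK, ?_⟩
    rintro _ ⟨_, ⟨t, rfl⟩, rfl⟩
    have h1 := (hQ t Kᶜ).trans (hKμ μ rfl)
    simp only [Measure.smul_apply, smul_eq_mul] at h1
    exact (ENNReal.mul_le_mul_iff_right ha hat).1 h1
  rw [tendsto_iff_ultrafilter]
  intro U hU
  obtain ⟨ν', -, hν'⟩ := htight.ultrafilter_le_nhds (U.map (S.QnuP ν)) (by
    rw [le_principal_iff]
    exact Ultrafilter.mem_map.2 (Filter.mem_of_superset Filter.univ_mem fun t _ =>
      subset_closure ⟨t, rfl⟩))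
  have hlim : Tendsto (S.QnuP ν) U (𝓝 ν') := hν'
  suffices hh : (ν' : Measure X) = μ by
    have : ν' = ⟨μ, inferInstance⟩ := Subtype.ext hh
    rw [← this]; exact hlim
  have hint := ProbabilityMeasure.tendsto_iff_forall_integral_tendsto.1 hlim
  refine S.eq_of_smul_le μ ν' hμ ⟨inferInstance, fun r hr => ?_⟩ a ha ?_
  · have e : S.Pmeas r ν' = (ν' : Measure X).bind (S.ker r) := by
      simp [Pmeas, ker, max_eq_left hr]
    have : IsProbabilityMeasure ((ν' : Measure X).bind (S.ker r)) :=
      inferInstanceAs (IsProbabilityMeasure ((S.ker r) ∘ₘ (ν' : Measure X)))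
    rw [e]
    refine ext_of_forall_integral_eq_of_IsFiniteMeasure fun f => ?_
    rw [integral_comp_kernel]
    have l1 := hint (S.PfB r hr f)
    have l2 := hint f
    have l3 : Tendsto (fun t => ∫ y, S.PfB r hr f y ∂ (S.QnuP ν t : Measure X)
        - ∫ y, f y ∂ (S.QnuP ν t : Measure X)) U (𝓝 0) := by
      refine Tendsto.mono_left ?_ hU
      refine squeeze_zero_norm' (a := fun t => (2 * r * ‖f‖) / t) ?_
        (tendsto_const_nhds.div_atTop tendsto_id)
      filter_upwards [eventually_ge_atTop 1] with t ht
      exact S.integral_Qnu_shift ν ht hr f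
    have l4 := sub_eq_zero.1 (tendsto_nhds_unique (l1.sub l2) l3)
    rw [← l4]
    simp only [ker, max_eq_left hr, Kernel.coe_mk]
    rfl
  · refine Measure.le_iff.2 fun A hA => ?_
    rw [A.measure_eq_iInf_isOpen μ]
    refine le_iInf fun G => le_iInf fun hAG => le_iInf fun hG => ?_
    have h1 := ProbabilityMeasure.le_liminf_measure_open_of_tendsto hlim hG
    have h2 : (ν' : Measure X) G ≤ a⁻¹ * μ G := by
      refine h1.trans ?_
      refine (liminf_le_liminf (v := fun _ => a⁻¹ * μ G) (Eventually.of_forall fun t => ?_)).trans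
        (liminf_const _).le
      have := hQ t G
      simp only [Measure.smul_apply, smul_eq_mul] at this
      rw [← ENNReal.div_eq_inv_mul, ENNReal.le_div_iff_mul_le (Or.inl ha) (Or.inl hat), mul_comm]
      exact this
    simp only [Measure.smul_apply, smul_eq_mul]
    calc a * (ν' : Measure X) A ≤ a * (a⁻¹ * μ G) := by
          gcongr
          exact (measure_mono hAG).trans h2
      _ = μ G := by rw [← mul_assoc, ENNReal.mul_inv_cancel ha hat, one_mul]

theorem exists_ball (z : X) (hz : S.CesaroEvContAt z) (f : BoundedContinuousFunction X ℝ)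
    (hf : ∃ K, LipschitzWith K f) (ε : ℝ) (hε : 0 < ε) :
    ∃ δ > 0, ∀ x ∈ ball z δ, ∀ᶠ t in atTop, |S.Qf t f x - S.Qf t f z| < ε := by
  have h := hz f ⟨hf, ‖f‖, fun x => f.norm_coe_le_norm x⟩
  have hb : ∀ x, ∀ᶠ t in atTop, |S.Qf t f x - S.Qf t f z| ≤ 2 * ‖f‖ := fun x => by
    filter_upwards [eventually_ge_atTop 1] with t ht
    have := S.abs_Qf_le ht f x
    have := S.abs_Qf_le ht f z
    exact (abs_sub _ _).trans (by linarith)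
  have hbd : ∀ x, IsBoundedUnder (· ≤ ·) atTop fun t => |S.Qf t f x - S.Qf t f z| :=
    fun x => ⟨_, eventually_map.2 (hb x)⟩
  have hcb : ∀ x, IsCoboundedUnder (· ≤ ·) atTop fun t => |S.Qf t f x - S.Qf t f z| :=
    fun x => IsBoundedUnder.isCoboundedUnder_le
      ⟨0, eventually_map.2 (Eventually.of_forall fun t => abs_nonneg _)⟩
  have ho : IsBoundedUnder (· ≤ ·) (𝓝 z)
      fun x => limsup (fun t => |S.Qf t f x - S.Qf t f z|) atTop :=
    ⟨2 * ‖f‖, eventually_map.2 (Eventually.of_forall fun x => limsup_le_of_le (hcb x) (hb x))⟩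
  have h2 := eventually_lt_of_limsup_lt (b := ε) (by rw [h]; exact hε) ho
  obtain ⟨δ, hδ, hd⟩ := Metric.eventually_nhds_iff_ball.1 h2
  exact ⟨δ, hδ, fun x hx => eventually_lt_of_limsup_lt (hd x hx) (hbd x)⟩

theorem tendsto_Qf_lipschitz [CompleteSpace X] (μ : Measure X) (hμ : S.ErgodicInv μ) (z : X)
    (hz : S.CesaroEvContAt z) (hzμ : z ∈ msupp μ) (f : BoundedContinuousFunction X ℝ)
    (hf : ∃ K, LipschitzWith K f) :
    Tendsto (fun t => S.Qf t f z) atTop (𝓝 (∫ y, f y ∂μ)) := by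
  have := hμ.1.1
  rw [Metric.tendsto_nhds]
  intro ε hε
  obtain ⟨δ, hδ, hd⟩ := S.exists_ball z hz f hf (ε / 3) (by positivity)
  set B := ball z δ with hB
  have hB0 : μ B ≠ 0 := (hzμ δ hδ).ne'
  set ν := ProbabilityTheory.cond μ B with hν
  have : IsProbabilityMeasure ν := cond_isProbabilityMeasure hB0
  have hle : μ B • ν ≤ μ := by
    rw [hν, ProbabilityTheory.cond, smul_smul, ENNReal.mul_inv_cancel hB0 (measure_ne_top μ B),
      one_smul]
    exact Measure.restrict_le_self
  have l1 := ProbabilityMeasure.tendsto_iff_forall_integral_tendsto.1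
    (S.tendsto_QnuP μ ν hμ _ hB0 hle) f
  have hae : ∀ᵐ x ∂ν, x ∈ B := ae_cond_mem measurableSet_ball
  -- the excess over `ε / 3` tends to zero in the mean
  have l2 : Tendsto (fun t => ∫ x, max (|S.Qf t f x - S.Qf t f z| - ε / 3) 0 ∂ν) atTop
      (𝓝 (∫ x, (0 : ℝ) ∂ν)) := by
    refine tendsto_integral_filter_of_dominated_convergence (fun _ => 2 * ‖f‖) ?_ ?_
      (integrable_const _) ?_
    · filter_upwards [eventually_ge_atTop 1] with t ht
      have hm := (S.measurable_Qf ht f).measurable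
      exact (by fun_prop : Measurable fun x =>
        max (|S.Qf t f x - S.Qf t f z| - ε / 3) 0).aestronglyMeasurable
    · filter_upwards [eventually_ge_atTop 1] with t ht
      refine Eventually.of_forall fun x => ?_
      have h1 := S.abs_Qf_le ht f x
      have h2 := S.abs_Qf_le ht f z
      have h3 := abs_sub (S.Qf t f x) (S.Qf t f z)
      rw [Real.norm_of_nonneg (le_max_right _ _)]
      exact max_le (by linarith) (by positivity)
    · filter_upwards [hae] with x hx
      refine tendsto_const_nhds.congr' ?_
      filter_upwards [hd x hx] with t ht
      exact (max_eq_right (by linarith)).symm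
  simp only [integral_zero] at l2
  filter_upwards [eventually_ge_atTop 1, Metric.tendsto_nhds.1 l1 (ε / 3) (by positivity),
    l2.eventually_lt_const (show (0 : ℝ) < ε / 3 by positivity)] with t ht h1 h2
  have e1 : ∫ y, f y ∂ (S.QnuP ν t : Measure X) = ∫ x, S.Qf t f x ∂ν := S.integral_Qnu ν ht f
  rw [e1, Real.dist_eq] at h1
  change |_ - ∫ y, f y ∂μ| < _ at h1
  rw [Real.dist_eq]
  have hm := (S.measurable_Qf ht f)
  have hi : Integrable (S.Qf t f) ν := Integrable.of_bound hm.aestronglyMeasurable ‖f‖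
    (Eventually.of_forall fun x => S.abs_Qf_le ht f x)
  have hi2 : Integrable (fun x => |S.Qf t f x - S.Qf t f z|) ν :=
    (hi.sub (integrable_const _)).abs
  have hi3 : Integrable (fun x => max (|S.Qf t f x - S.Qf t f z| - ε / 3) 0) ν :=
    (hi2.sub (integrable_const (ε / 3))).pos_part
  have e2 : |∫ x, S.Qf t f x ∂ν - S.Qf t f z| ≤
      ∫ x, max (|S.Qf t f x - S.Qf t f z| - ε / 3) 0 ∂ν + ε / 3 := by
    calc _ = |∫ x, (S.Qf t f x - S.Qf t f z) ∂ν| := by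
          rw [integral_sub hi (integrable_const _)]; simp
      _ ≤ ∫ x, |S.Qf t f x - S.Qf t f z| ∂ν := abs_integral_le_integral_abs
      _ ≤ ∫ x, (max (|S.Qf t f x - S.Qf t f z| - ε / 3) 0 + ε / 3) ∂ν := by
          refine integral_mono hi2 (hi3.add (integrable_const _)) fun x => ?_
          have := le_max_left (|S.Qf t f x - S.Qf t f z| - ε / 3) 0
          simp only
          linarith
      _ = _ := by rw [integral_add hi3 (integrable_const _)]; simp
  rw [abs_lt] at h1 ⊢
  rw [abs_le] at e2
  constructor <;> linarith

end Aux

section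

variable {X : Type*} [MetricSpace X] [CompleteSpace X]
  [TopologicalSpace.SeparableSpace X] [MeasurableSpace X] [BorelSpace X]

theorem qWeakLim_of_mem_msupp_ergodic (S : MarkovFellerSemigroup X)
    (h : ∀ z : X, S.CesaroEvContAt z) (μ : Measure X) (hμ : S.ErgodicInv μ) :
    ∀ x ∈ msupp μ, S.QWeakLim x μ := by
  intro x hx f
  have := hμ.1.1
  have key : Tendsto (S.QnuP (Measure.dirac x)) atTop (𝓝 ⟨μ, inferInstance⟩) := by
    refine tendsto_iff_forall_lipschitz_integral_tendsto.2 ?_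
    rintro g ⟨C, hC⟩ ⟨K, hK⟩
    let g' : BoundedContinuousFunction X ℝ := ⟨⟨g, hK.continuous⟩, C, hC⟩
    refine (S.tendsto_Qf_lipschitz μ hμ x (h x) hx g' ⟨K, hK⟩).congr' ?_
    filter_upwards [eventually_ge_atTop 1] with t ht
    have e := S.integral_Qnu (Measure.dirac x) ht g'
    rw [integral_dirac] at e
    exact e.symm
  have l := ProbabilityMeasure.tendsto_iff_forall_integral_tendsto.1 key f
  refine l.congr' ?_
  filter_upwards [eventually_ge_atTop 1] with t ht
  have e := S.integral_Qnu (Measure.dirac x) ht f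
  rw [integral_dirac] at e
  exact e

end

end MarkovFellerSemigroup
end
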